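/- arXiv:1110.6091 — 8 statements merged into one kernel-verified Lean document; each statement's English description precedes it below -/
import Mathlib

section
/- Suppose there exist x ∈ X, a continuous function φ : X → ℝ and real numbers a₁ < a₂ with liminf_{n→∞} (1/n) Σ_{i=0}^{n−1} φ(f^i(x)) < a₁ < a₂ < limsup_{n→∞} (1/n) Σ_{i=0}^{n−1} φ(f^i(x)). Then for every μ ∈ M_inv(X,f), the set G_μ ∩ closure({f^n(x) : n ≥ 0}) is meager (of first category) in the subspace closure({f^n(x) : n ≥ 0}). -/
open MeasureTheory Filter Topology
open scoped ENNReal NNReal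

/-- The `n`-term empirical measure `E_n(x) = (1/n) ∑_{i<n} δ_{f^i x}`, as a `Measure`. -/
noncomputable def empMeasure {X : Type*} [MeasurableSpace X] (f : X → X) (x : X) (n : ℕ) :
    Measure X :=
  (n : ℝ≥0∞)⁻¹ • ∑ i ∈ Finset.range n, Measure.dirac (f^[i] x)

lemma empMeasure_isProbabilityMeasure {X : Type*} [MeasurableSpace X] (f : X → X) (x : X)
    (n : ℕ) (hn : n ≠ 0) : IsProbabilityMeasure (empMeasure f x n) := by
  constructor
  simp only [empMeasure, Measure.smul_apply, Measure.finset_sum_apply, measure_univ,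
    Finset.sum_const, Finset.card_range, nsmul_eq_mul, mul_one, smul_eq_mul]
  exact ENNReal.inv_mul_cancel (Nat.cast_ne_zero.mpr hn) (ENNReal.natCast_ne_top n)

/-- The empirical probability measure `E_{n+1}(x)`; the sequence `n ↦ empirical f x n`
is exactly the sequence `(E_n(x))_{n ≥ 1}` of the paper. -/
noncomputable def empirical {X : Type*} [MeasurableSpace X] (f : X → X) (x : X) (n : ℕ) :
    ProbabilityMeasure X :=
  ⟨empMeasure f x (n + 1), empMeasure_isProbabilityMeasure f x (n + 1) n.succ_ne_zero⟩

/-- The metric `D(μ,ν) = ∑_{i≥1} 2^{-(i+1)} |∫φ_i dμ − ∫φ_i dν| / ‖φ_i‖` on Borel probability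
measures, determined by a fixed sequence of test functions (here indexed from `0`, so the
`i`-th function carries the weight `2^{-(i+2)}`). -/
noncomputable def Dmet {X : Type*} [TopologicalSpace X] [CompactSpace X] [MeasurableSpace X]
    (φ : ℕ → C(X, ℝ)) (μ ν : Measure X) : ℝ :=
  ∑' i : ℕ, (2 : ℝ)⁻¹ ^ (i + 2) * |(∫ y, φ i y ∂μ) - ∫ y, φ i y ∂ν| / ‖φ i‖

lemma aux_shift {X : Type*} [MetricSpace X] [CompactSpace X]
    (f : X → X) (x : X) (φ : C(X, ℝ)) (m : ℕ) :
    Tendsto (fun n => birkhoffAverage ℝ f φ n (f^[m] x) - birkhoffAverage ℝ f φ n x)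
      atTop (𝓝 0) := by
  induction m with
  | zero => simp
  | succ k ih =>
    have hb : Bornology.IsBounded (Set.range (fun n => φ (f^[n] (f^[k] x)))) := by
      refine (isCompact_range φ.continuous).isBounded.subset ?_
      rintro _ ⟨n, rfl⟩
      exact ⟨_, rfl⟩
    have h := tendsto_birkhoffAverage_apply_sub_birkhoffAverage ℝ hb
    have h' := h.add ih
    simp only [add_zero, sub_add_sub_cancel] at h'
    simpa only [Function.iterate_succ_apply'] using h'

lemma aux_meagre {X : Type*} [MetricSpace X] [CompactSpace X]
    (f : X → X) (hf : Continuous f) (x : X) (φ : C(X, ℝ)) (a b : ℝ) (hba : b < a)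
    (h : ∃ᶠ n in atTop, birkhoffAverage ℝ f φ n x < b) :
    IsMeagre (Subtype.val ⁻¹' {y : X | ∀ᶠ n in atTop, a ≤ birkhoffAverage ℝ f φ n y} :
          Set (closure {y : X | ∃ n : ℕ, f^[n] x = y})) := by
  have hc : ∀ n, Continuous (fun y => birkhoffAverage ℝ f φ n y) := by
    intro n
    unfold birkhoffAverage birkhoffSum
    have hs : Continuous fun y => ∑ k ∈ Finset.range n, φ (f^[k] y) :=
      continuous_finsetSum _ fun i _ => φ.continuous.comp (hf.iterate i)
    exact hs.const_smul ((n : ℝ)⁻¹)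
  set F : ℕ → Set (closure {y : X | ∃ n : ℕ, f^[n] x = y}) := fun N =>
    Subtype.val ⁻¹' {y : X | ∀ n ≥ N, a ≤ birkhoffAverage ℝ f φ n y} with hF
  have hcl : ∀ N, IsClosed (F N) := by
    intro N
    refine IsClosed.preimage continuous_subtype_val ?_
    simp only [Set.setOf_forall]
    exact isClosed_iInter fun n => isClosed_iInter fun _ => isClosed_le continuous_const (hc n)
  have hm : IsMeagre (⋃ N, F N) := by
    refine isMeagre_iUnion fun N => IsNowhereDense.isMeagre ?_
    rw [(hcl N).isNowhereDense_iff, Set.eq_empty_iff_forall_notMem]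
    intro y hy
    obtain ⟨U, hU, hUo, hyU⟩ := mem_interior.1 hy
    obtain ⟨V, hV, rfl⟩ := isOpen_induced_iff.1 hUo
    obtain ⟨z, hzV, m, rfl⟩ := mem_closure_iff.1 y.2 V hV hyU
    have hz : ∀ n ≥ N, a ≤ birkhoffAverage ℝ f φ n (f^[m] x) :=
      hU (show (⟨f^[m] x, subset_closure ⟨m, rfl⟩⟩ :
        closure {y : X | ∃ n : ℕ, f^[n] x = y}) ∈ Subtype.val ⁻¹' V from hzV)
    have hs := (aux_shift f x φ m).eventually_lt_const (sub_pos.2 hba)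
    obtain ⟨n, h1, h2, h3⟩ := (h.and_eventually (hs.and (eventually_ge_atTop N))).exists
    have := hz n h3
    linarith
  refine hm.mono ?_
  intro y hy
  obtain ⟨N, hN⟩ := eventually_atTop.1 hy
  exact Set.mem_iUnion.2 ⟨N, hN⟩

lemma aux_tendsto {X : Type*} [MetricSpace X] [CompactSpace X] [MeasurableSpace X] [BorelSpace X]
    (f : X → X) (y : X) (φ : C(X, ℝ)) (μ : ProbabilityMeasure X)
    (h : Tendsto (fun n => empirical f y n) atTop (𝓝 μ)) :
    Tendsto (fun n => birkhoffAverage ℝ f φ n y) atTop (𝓝 (∫ z, φ z ∂(μ : Measure X))) := by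
  have h1 := (ProbabilityMeasure.tendsto_iff_forall_integral_tendsto.1 h)
    (BoundedContinuousFunction.mkOfCompact φ)
  rw [← tendsto_add_atTop_iff_nat 1]
  refine h1.congr fun n => ?_
  simp only [empirical, empMeasure, ProbabilityMeasure.coe_mk,
    BoundedContinuousFunction.mkOfCompact_apply]
  rw [integral_smul_measure, integral_finset_sum_measure]
  · have ht : ((n : ℝ≥0∞) + 1).toReal = n + 1 := by
      rw [ENNReal.toReal_add (by simp) (by simp)]
      simp
    simp [birkhoffAverage, birkhoffSum, integral_dirac, ht]
  · intro i _
    exact (BoundedContinuousFunction.mkOfCompact φ).integrable _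

/-- If for some point `x`, continuous `φ` and reals `a₁ < a₂` the Birkhoff
averages of `φ` along the orbit of `x` have liminf `< a₁` and limsup `> a₂`, then for every
invariant probability measure `μ` the set `G_μ ∩ closure(orbit of x)` is meager in the
subspace `closure(orbit of x)`. -/
theorem stmt2 {X : Type*} [MetricSpace X] [CompactSpace X] [MeasurableSpace X] [BorelSpace X]
    (f : X → X) (hf : Continuous f) (x : X) (φ : C(X, ℝ)) (a₁ a₂ : ℝ)
    (h1 : Filter.liminf
        (fun n : ℕ => (1 / n : ℝ) * ∑ i ∈ Finset.range n, φ (f^[i] x)) atTop < a₁)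
    (h12 : a₁ < a₂)
    (h2 : a₂ < Filter.limsup
        (fun n : ℕ => (1 / n : ℝ) * ∑ i ∈ Finset.range n, φ (f^[i] x)) atTop) :
    ∀ μ : ProbabilityMeasure X, (μ : Measure X).map f = (μ : Measure X) →
      IsMeagre
        (Subtype.val ⁻¹' {y : X | Tendsto (fun n => empirical f y n) atTop (𝓝 μ)} :
          Set (closure {y : X | ∃ n : ℕ, f^[n] x = y})) := by
  intro μ _
  have hav : ∀ (n : ℕ), (1 / n : ℝ) * ∑ i ∈ Finset.range n, φ (f^[i] x)
      = birkhoffAverage ℝ f φ n x := by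
    intro n
    simp [birkhoffAverage, birkhoffSum]
  simp only [hav] at h1 h2
  have hbd : ∀ n, |birkhoffAverage ℝ f φ n x| ≤ ‖φ‖ := by
    intro n
    rw [← hav, abs_mul, abs_of_nonneg (by positivity : (0 : ℝ) ≤ 1 / n)]
    have : |∑ i ∈ Finset.range n, φ (f^[i] x)| ≤ n * ‖φ‖ := by
      refine (Finset.abs_sum_le_sum_abs _ _).trans ?_
      refine (Finset.sum_le_sum fun i _ => φ.norm_coe_le_norm (f^[i] x)).trans ?_
      simp
    rcases Nat.eq_zero_or_pos n with rfl | hn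
    · simp
    · have hn' : (0 : ℝ) < n := by exact_mod_cast hn
      rw [one_div, inv_mul_le_iff₀ hn']
      exact this
  rcases lt_or_ge a₁ (∫ z, φ z ∂(μ : Measure X)) with hc | hc
  · obtain ⟨b, hb1, hb2⟩ := exists_between h1
    have hfr : ∃ᶠ n in atTop, birkhoffAverage ℝ f φ n x < b := by
      refine frequently_lt_of_liminf_lt ?_ hb1
      exact IsBoundedUnder.isCoboundedUnder_ge
        (isBoundedUnder_of ⟨‖φ‖, fun n => (abs_le.1 (hbd n)).2⟩)
    refine (aux_meagre f hf x φ a₁ b hb2 hfr).mono ?_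
    intro y hy
    exact ((aux_tendsto f y φ μ hy).eventually_const_lt hc).mono fun n hn => hn.le
  · obtain ⟨b, hb1, hb2⟩ := exists_between h2
    have hneg : ∀ n y, birkhoffAverage ℝ f (-φ) n y = - birkhoffAverage ℝ f φ n y := by
      intro n y
      simp [birkhoffAverage, birkhoffSum]
    have hneg' : ∀ n y, birkhoffAverage ℝ f (⇑(-φ)) n y = - birkhoffAverage ℝ f φ n y := hneg
    have hfr : ∃ᶠ n in atTop, b < birkhoffAverage ℝ f φ n x := by
      refine frequently_lt_of_lt_limsup ?_ hb2
      exact IsBoundedUnder.isCoboundedUnder_le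
        (isBoundedUnder_of ⟨-‖φ‖, fun n => (abs_le.1 (hbd n)).1⟩)
    refine (aux_meagre f hf x (-φ) (-a₂) (-b) (neg_lt_neg hb1)
      (hfr.mono fun n hn => by rw [hneg']; linarith)).mono ?_
    intro y hy
    refine ((aux_tendsto f y φ μ hy).eventually_lt_const (hc.trans_lt h12)).mono fun n hn => ?_
    rw [hneg']
    linarith
end

section
/- If μ is an f-invariant Borel probability measure on X which is not ergodic, then μ(G_μ) = 0. -/
open MeasureTheory Filter Topology
open scoped ENNReal NNReal

lemma aux_empirical {X : Type*} [MetricSpace X] [CompactSpace X] [MeasurableSpace X] [BorelSpace X]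
    (f : X → X) (x : X) (n : ℕ) (φ : C(X, ℝ)) :
    ∫ y, φ y ∂(empirical f x n : Measure X) = birkhoffAverage ℝ f φ (n + 1) x := by
  change ∫ y, φ y ∂(empMeasure f x (n + 1)) = _
  unfold empMeasure
  rw [integral_smul_measure, integral_finset_sum_measure]
  · simp only [birkhoffAverage, birkhoffSum, integral_dirac, ENNReal.toReal_inv,
      ENNReal.toReal_natCast]
  · intro i _
    exact integrable_dirac (by simp)

lemma aux_average {X : Type*} [MetricSpace X] [CompactSpace X] [MeasurableSpace X] [BorelSpace X]
    (f : X → X) (ν : Measure X) [IsFiniteMeasure ν] (hmp : MeasurePreserving f ν ν)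
    (hf : Continuous f) (φ : C(X, ℝ)) (n : ℕ) :
    ∫ y, birkhoffAverage ℝ f φ (n + 1) y ∂ν = ∫ y, φ y ∂ν := by
  have hint : ∀ i, Integrable (fun y => φ (f^[i] y)) ν := fun i =>
    (φ.continuous.comp (hf.iterate i)).integrable_of_hasCompactSupport
      (HasCompactSupport.of_compactSpace _)
  simp only [birkhoffAverage, birkhoffSum]
  rw [integral_smul, integral_finsetSum _ (fun i _ => hint i)]
  have : ∀ i, ∫ y, φ (f^[i] y) ∂ν = ∫ y, φ y ∂ν := by
    intro i
    have h := hmp.iterate i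
    conv_rhs => rw [← h.map_eq]
    rw [integral_map h.measurable.aemeasurable φ.continuous.aestronglyMeasurable]
  simp only [this]
  simp only [Finset.sum_const, Finset.card_range, nsmul_eq_mul, smul_eq_mul]
  field_simp

lemma aux_bound {X : Type*} [MetricSpace X] [CompactSpace X]
    (f : X → X) (φ : C(X, ℝ)) (n : ℕ) (y : X) :
    ‖birkhoffAverage ℝ f φ (n + 1) y‖ ≤ ‖φ‖ := by
  simp only [birkhoffAverage, birkhoffSum, norm_smul]
  have : ‖∑ k ∈ Finset.range (n + 1), φ (f^[k] y)‖ ≤ (n + 1 : ℕ) * ‖φ‖ := by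
    refine (norm_sum_le_of_le _ (fun i _ => φ.norm_coe_le_norm _)).trans ?_
    simp
  rw [norm_inv, Real.norm_natCast, inv_mul_le_iff₀ (by positivity)]
  exact this

lemma aux_cont {X : Type*} [MetricSpace X] [CompactSpace X]
    (f : X → X) (hf : Continuous f) (φ : C(X, ℝ)) (n : ℕ) :
    Continuous (birkhoffAverage ℝ f φ n) := by
  unfold birkhoffAverage birkhoffSum
  exact Continuous.const_smul (continuous_finsetSum _ fun i _ => φ.continuous.comp (hf.iterate i)) (n : ℝ)⁻¹

lemma aux_intcont {X : Type*} [MetricSpace X] [CompactSpace X] [MeasurableSpace X] [BorelSpace X]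
    (ν : Measure X) [IsFiniteMeasure ν] : Continuous (fun φ : C(X, ℝ) => ∫ y, φ y ∂ν) := by
  refine continuous_iff_continuousAt.2 fun φ => ?_
  have hb : ∀ᶠ ψ : C(X, ℝ) in 𝓝 φ, ‖ψ‖ ≤ ‖φ‖ + 1 :=
    (continuous_norm.tendsto φ).eventually (eventually_le_nhds (by linarith))
  refine tendsto_integral_filter_of_dominated_convergence (fun _ => ‖φ‖ + 1) ?_ ?_
    (integrable_const _) ?_
  · exact Eventually.of_forall fun ψ => ψ.continuous.aestronglyMeasurable
  · filter_upwards [hb] with ψ hψ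
    exact Eventually.of_forall fun y => (ψ.norm_coe_le_norm y).trans hψ
  · exact Eventually.of_forall fun y => (ContinuousEvalConst.continuous_eval_const y).tendsto φ

lemma aux_core {X : Type*} [MetricSpace X] [CompactSpace X] [MeasurableSpace X] [BorelSpace X]
    (f : X → X) (hf : Continuous f) (μ : Measure X) [IsProbabilityMeasure μ]
    (hmp : MeasurePreserving f μ μ) (φ : ℕ → C(X, ℝ)) (hφ : DenseRange φ)
    (S : Set X) (hS : MeasurableSet S) (hfS : f ⁻¹' S = S)
    (hT : ∀ x ∈ S, ∀ k, Tendsto (fun n => birkhoffAverage ℝ f (φ k) (n + 1) x) atTop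
      (𝓝 (∫ y, φ k y ∂μ))) : μ.restrict S = μ S • μ := by
  have hmpS : MeasurePreserving f (μ.restrict S) (μ.restrict S) := by
    have := hmp.restrict_preimage hS
    rwa [hfS] at this
  haveI : IsFiniteMeasure (μ S • μ) := Measure.smul_finite _ (measure_ne_top _ _)
  have key : ∀ k, ∫ y, φ k y ∂(μ.restrict S) = ∫ y, φ k y ∂(μ S • μ) := by
    intro k
    have h1 : Tendsto (fun n => ∫ y, birkhoffAverage ℝ f (φ k) (n + 1) y ∂(μ.restrict S)) atTop
        (𝓝 (∫ _, (∫ y, φ k y ∂μ) ∂(μ.restrict S))) := by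
      refine tendsto_integral_of_dominated_convergence (fun _ => ‖φ k‖) ?_ (integrable_const _) ?_ ?_
      · exact fun n => (aux_cont f hf _ _).aestronglyMeasurable
      · exact fun n => Eventually.of_forall fun y => aux_bound f _ n y
      · filter_upwards [ae_restrict_mem hS] with y hy using hT y hy k
    simp only [aux_average f _ hmpS hf] at h1
    rw [tendsto_nhds_unique tendsto_const_nhds h1, integral_smul_measure]
    simp [Measure.real]
  have key2 := hφ.equalizer (aux_intcont (μ.restrict S)) (aux_intcont (μ S • μ)) (funext key)
  refine ext_of_forall_integral_eq_of_IsFiniteMeasure fun g => ?_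
  exact congrFun key2 g.toContinuousMap

/-- If `μ` is an `f`-invariant Borel probability measure on `X` which is not
ergodic, then `μ(G_μ) = 0`. -/
theorem stmt4 {X : Type*} [MetricSpace X] [CompactSpace X] [MeasurableSpace X] [BorelSpace X]
    (f : X → X) (hf : Continuous f) (μ : ProbabilityMeasure X)
    (hinv : (μ : Measure X).map f = (μ : Measure X))
    (hne : ¬ Ergodic f (μ : Measure X)) :
    (μ : Measure X) {x : X | Tendsto (fun n => empirical f x n) atTop (𝓝 μ)} = 0 := by
  have hmp : MeasurePreserving f (μ : Measure X) μ := ⟨hf.measurable, hinv⟩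
  obtain ⟨B, hB, hfB, hBc⟩ : ∃ B, MeasurableSet B ∧ f ⁻¹' B = B ∧
      ¬ EventuallyConst B (ae (μ : Measure X)) := by
    by_contra! h
    exact hne ⟨hmp, ⟨fun s hs hfs => h s hs hfs⟩⟩
  rw [eventuallyConst_set'] at hBc
  have hB0 : (μ : Measure X) B ≠ 0 := fun h => hBc (Or.inl (ae_eq_empty.2 h))
  have hB1 : (μ : Measure X) Bᶜ ≠ 0 := fun h => hBc (Or.inr (ae_eq_univ.2 h))
  obtain ⟨φ, hφ⟩ := TopologicalSpace.exists_dense_seq C(X, ℝ)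
  let G : Set X := {x | ∀ k, Tendsto (fun n => birkhoffAverage ℝ f (φ k) (n + 1) x) atTop
      (𝓝 (∫ y, φ k y ∂(μ : Measure X)))}
  have hG : MeasurableSet G := by
    have : G = ⋂ k, {x | Tendsto (fun n => birkhoffAverage ℝ f (φ k) (n + 1) x) atTop
      (𝓝 (∫ y, φ k y ∂(μ : Measure X)))} := by ext; simp [G]
    rw [this]
    exact MeasurableSet.iInter fun k =>
      measurableSet_tendsto _ fun n => (aux_cont f hf _ _).measurable
  have hfG : f ⁻¹' G = G := by
    ext x
    refine forall_congr' fun k => ?_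
    have h0 := (tendsto_birkhoffAverage_apply_sub_birkhoffAverage' (𝕜 := ℝ) (f := f)
      (g := φ k) (isCompact_range (φ k).continuous).isBounded x).comp (tendsto_add_atTop_nat 1)
    constructor
    · intro h
      simpa using h.sub h0
    · intro h
      simpa using h.add h0
  have hsub : {x : X | Tendsto (fun n => empirical f x n) atTop (𝓝 μ)} ⊆ G := by
    intro x hx k
    have := (ProbabilityMeasure.tendsto_iff_forall_integral_tendsto.1 hx)
      (BoundedContinuousFunction.mkOfCompact (φ k))
    simpa [aux_empirical] using this
  have h1 : (μ : Measure X) (B ∩ G) = 0 := by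
    have h := aux_core f hf μ hmp φ hφ (B ∩ G) (hB.inter hG)
      (by rw [Set.preimage_inter, hfB, hfG]) (fun x hx => hx.2)
    have h2 := congrArg (fun m : Measure X => m Bᶜ) h
    simp only [Measure.restrict_apply hB.compl, Measure.smul_apply, smul_eq_mul] at h2
    have h3 : Bᶜ ∩ (B ∩ G) = ∅ := by ext; simp; tauto
    rw [h3, measure_empty] at h2
    exact (mul_eq_zero.1 h2.symm).resolve_right hB1
  have h1' : (μ : Measure X) (Bᶜ ∩ G) = 0 := by
    have h := aux_core f hf μ hmp φ hφ (Bᶜ ∩ G) (hB.compl.inter hG)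
      (by rw [Set.preimage_inter, Set.preimage_compl, hfB, hfG]) (fun x hx => hx.2)
    have h2 := congrArg (fun m : Measure X => m B) h
    simp only [Measure.restrict_apply hB, Measure.smul_apply, smul_eq_mul] at h2
    have h3 : B ∩ (Bᶜ ∩ G) = ∅ := by ext; simp; tauto
    rw [h3, measure_empty] at h2
    exact (mul_eq_zero.1 h2.symm).resolve_right hB0
  refine measure_mono_null (t := (B ∩ G) ∪ (Bᶜ ∩ G)) ?_ (measure_union_null h1 h1')
  intro x hx
  have := hsub hx
  by_cases hxB : x ∈ B
  · exact Or.inl ⟨hxB, this⟩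
  · exact Or.inr ⟨hxB, this⟩
end

section
/- Let f : X → X be a bijection with f and f^{-1} measurable, preserving a Borel probability measure μ on X, let ξ = {ξ^1,…,ξ^r} be a finite partition of X into measurable sets, and let ε > 0. Then for μ-almost every x ∈ X there exists T(x) ∈ ℕ such that for every integer t ≥ T(x) there is an integer q with t ≤ q ≤ (1+ε)t and f^q(x) ∈ ξ(x), where ξ(x) denotes the element of ξ containing x. Consequently, μ({ x ∈ X : ∃ q ∈ ℕ, t ≤ q ≤ (1+ε)t, f^q(x) ∈ ξ(x) }) tends to 1 as t → ∞. -/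
open MeasureTheory Filter Topology
open scoped ENNReal NNReal


def gapSet {X : Type*} (e : X → X) (A : Set X) (n : ℕ) : Set X :=
  {x | x ∈ A ∧ ∀ i, 1 ≤ i → i ≤ n → e^[i] x ∉ A}

lemma gapSet_meas {X : Type*} [MeasurableSpace X] {e : X → X} (he : Measurable e) {A : Set X}
    (hA : MeasurableSet A) (n : ℕ) : MeasurableSet (gapSet e A n) := by
  have : gapSet e A n = A ∩ ⋂ i, ⋂ (_ : 1 ≤ i), ⋂ (_ : i ≤ n), (e^[i] ⁻¹' A)ᶜ := by
    ext x; simp [gapSet]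
  rw [this]
  refine hA.inter (MeasurableSet.iInter fun i => MeasurableSet.iInter fun _ =>
    MeasurableSet.iInter fun _ => ((he.iterate i) hA).compl)

lemma gap_sum {X : Type*} [MeasurableSpace X] (μ : Measure X) [IsProbabilityMeasure μ]
    (e : X ≃ X) (hme : Measurable ⇑e) (hme' : Measurable ⇑e.symm)
    (hpres : MeasurePreserving ⇑e μ μ) {A : Set X} (hA : MeasurableSet A) :
    ∑' n, μ (gapSet e A n) ≤ 1 := by
  have hs : MeasurePreserving ⇑e.symm μ μ := by
    let E : X ≃ᵐ X := ⟨e, hme, hme'⟩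
    exact MeasurePreserving.symm E hpres
  have h1 : ∀ n, μ (gapSet e A n) = μ ((e.symm)^[n] ⁻¹' gapSet e A n) := fun n =>
    ((hs.iterate n).measure_preimage (gapSet_meas hme hA n).nullMeasurableSet).symm
  simp_rw [h1]
  rw [← measure_iUnion]
  · exact prob_le_one
  · have key : ∀ n k : ℕ, n < k →
        Disjoint ((e.symm)^[n] ⁻¹' gapSet e A n) ((e.symm)^[k] ⁻¹' gapSet e A k) := by
      intro n k hnk
      rw [Set.disjoint_left]
      intro y hy hy'
      refine hy'.2 (k - n) (by omega) (by omega) ?_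
      have : e^[k - n] ((e.symm)^[k] y) = (e.symm)^[n] y := by
        conv_lhs => rw [show k = (k - n) + n by omega, Function.iterate_add_apply]
        rw [show k - n + n - n = k - n by omega]
        exact (Function.RightInverse.iterate e.apply_symm_apply (k - n)) _
      rw [this]
      exact hy.1
    intro n k hnk
    rcases lt_or_gt_of_ne hnk with h | h
    · exact key _ _ h
    · exact (key _ _ h).symm
  · intro n
    exact (hme'.iterate n) (gapSet_meas hme hA n)

lemma gap_ae {X : Type*} [MeasurableSpace X] (μ : Measure X) [IsProbabilityMeasure μ]
    (e : X ≃ X) (hme : Measurable ⇑e) (hme' : Measurable ⇑e.symm)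
    (hpres : MeasurePreserving ⇑e μ μ) {A : Set X} (hA : MeasurableSet A) (m : ℕ) [NeZero m] :
    ∀ᵐ x ∂μ, ∀ᶠ j in atTop, e^[j] x ∉ gapSet e A (j / m) := by
  refine ae_eventually_notMem (s := fun j => e^[j] ⁻¹' gapSet e A (j / m)) ?_
  have h1 : ∀ j, μ (e^[j] ⁻¹' gapSet e A (j / m)) = μ (gapSet e A (j / m)) := fun n =>
    ((hpres.iterate n).measure_preimage (gapSet_meas hme hA _).nullMeasurableSet)
  simp_rw [h1]
  rw [show ∑' j, μ (gapSet e A (j / m)) = ∑' p : ℕ × Fin m, μ (gapSet e A p.1) from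
    (Nat.divModEquiv m).tsum_eq (fun p : ℕ × Fin m => μ (gapSet e A p.1))]
  rw [ENNReal.tsum_prod (f := fun n (_ : Fin m) => μ (gapSet e A n)), ENNReal.tsum_comm]
  have := gap_sum μ e hme hme' hpres hA
  simp only [tsum_fintype, Finset.sum_const, nsmul_eq_mul]
  exact ENNReal.mul_ne_top (by simp) (ne_top_of_le_ne_top ENNReal.one_ne_top this)

lemma visit_ae {X : Type*} [MeasurableSpace X] (μ : Measure X) [IsProbabilityMeasure μ]
    (e : X ≃ X) (hme : Measurable ⇑e) (hme' : Measurable ⇑e.symm)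
    (hpres : MeasurePreserving ⇑e μ μ) {A : Set X} (hA : MeasurableSet A)
    (ε : ℝ) (hε : 0 < ε) :
    ∀ᵐ x ∂μ, x ∈ A → ∃ T : ℕ, ∀ t : ℕ, T ≤ t →
        ∃ q : ℕ, (t : ℝ) ≤ q ∧ (q : ℝ) ≤ (1 + ε) * t ∧ (⇑e)^[q] x ∈ A := by
  classical
  obtain ⟨k, hk⟩ := exists_nat_one_div_lt hε
  filter_upwards [gap_ae μ e hme hme' hpres hA (k + 1),
    hpres.conservative.ae_mem_imp_frequently_image_mem hA.nullMeasurableSet] with x hx hx2 hxA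
  obtain ⟨J, hJ⟩ := eventually_atTop.1 hx
  obtain ⟨j0, hj0, hj0A⟩ := frequently_atTop.1 (hx2 hxA) J
  refine ⟨j0 + 1, fun t ht => ?_⟩
  have hle : j0 ≤ t - 1 := by omega
  set j := Nat.findGreatest (fun j => e^[j] x ∈ A) (t - 1) with hj
  have hjA : e^[j] x ∈ A := Nat.findGreatest_spec (P := fun j => e^[j] x ∈ A) hle hj0A
  have hj1 : j0 ≤ j := Nat.le_findGreatest (P := fun j => e^[j] x ∈ A) hle hj0A
  have hj2 : j ≤ t - 1 := Nat.findGreatest_le _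
  have hg := hJ j (by omega)
  simp only [gapSet, Set.mem_ofPred_eq, not_and, not_forall, not_not] at hg
  obtain ⟨i, hi1, hi2, hiA⟩ := hg hjA
  rw [← Function.iterate_add_apply] at hiA
  refine ⟨i + j, ?_, ?_, hiA⟩
  · by_contra hlt
    have hlt : i + j < t := by exact_mod_cast not_le.1 hlt
    have := Nat.le_findGreatest (P := fun j => e^[j] x ∈ A) (show i + j ≤ t - 1 by omega) hiA
    omega
  · have h3 : (i : ℝ) ≤ j / ((k + 1 : ℕ) : ℝ) :=
      le_trans (by exact_mod_cast hi2) Nat.cast_div_le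
    have hjt : (j : ℝ) ≤ t := by exact_mod_cast (by omega : j ≤ t)
    have h4 : (j : ℝ) / ((k + 1 : ℕ) : ℝ) ≤ ε * t := by
      rw [div_eq_mul_one_div, mul_comm]
      push_cast
      gcongr
    push_cast
    linarith

/-- Let `f` be an invertible bimeasurable map preserving a probability measure
`μ`, `ξ` a finite measurable partition of `X` and `ε > 0`. Then for a.e. `x` there is
`T(x) ∈ ℕ` such that for every `t ≥ T(x)` some iterate `f^q(x)` with `t ≤ q ≤ (1+ε)t` returns
to the partition element `ξ(x)` of `x`; consequently the measure of the set of such points at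
time `t` tends to `1` as `t → ∞`. -/
theorem stmt6 {X : Type*} [MeasurableSpace X] (μ : Measure X) [IsProbabilityMeasure μ]
    (e : X ≃ X) (hme : Measurable ⇑e) (hme' : Measurable ⇑e.symm)
    (hpres : MeasurePreserving ⇑e μ μ)
    (ξ : Finset (Set X)) (hmeas : ∀ s ∈ ξ, MeasurableSet s)
    (hdisj : ∀ s ∈ ξ, ∀ t ∈ ξ, s ≠ t → Disjoint s t)
    (hcover : ⋃ s ∈ ξ, s = Set.univ)
    (ε : ℝ) (hε : 0 < ε) :
    (∀ᵐ x ∂μ, ∃ T : ℕ, ∀ t : ℕ, T ≤ t →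
        ∃ q : ℕ, (t : ℝ) ≤ q ∧ (q : ℝ) ≤ (1 + ε) * t ∧ ∃ s ∈ ξ, x ∈ s ∧ (⇑e)^[q] x ∈ s) ∧
      Tendsto
        (fun t : ℕ => μ {x : X |
          ∃ q : ℕ, (t : ℝ) ≤ q ∧ (q : ℝ) ≤ (1 + ε) * t ∧ ∃ s ∈ ξ, x ∈ s ∧ (⇑e)^[q] x ∈ s})
        atTop (𝓝 1) := by
  have h1 : ∀ᵐ x ∂μ, ∃ T : ℕ, ∀ t : ℕ, T ≤ t →
        ∃ q : ℕ, (t : ℝ) ≤ q ∧ (q : ℝ) ≤ (1 + ε) * t ∧ ∃ s ∈ ξ, x ∈ s ∧ (⇑e)^[q] x ∈ s := by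
    have := (ae_ball_iff ξ.countable_toSet).2 fun s (hs : s ∈ (ξ : Set (Set X))) =>
      visit_ae μ e hme hme' hpres (hmeas s hs) ε hε
    filter_upwards [this] with x hx
    have hxu : x ∈ ⋃ s ∈ ξ, s := hcover ▸ Set.mem_univ x
    simp only [Set.mem_iUnion] at hxu
    obtain ⟨s, hs, hxs⟩ := hxu
    obtain ⟨T, hT⟩ := hx s hs hxs
    refine ⟨T, fun t ht => ?_⟩
    obtain ⟨q, ha, hb, hc⟩ := hT t ht
    exact ⟨q, ha, hb, s, hs, hxs, hc⟩
  refine ⟨h1, ?_⟩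
  rw [← measure_univ (μ := μ)]
  refine tendsto_measure_of_ae_tendsto_indicator_of_isFiniteMeasure atTop MeasurableSet.univ ?_ ?_
  · intro t
    have : {x : X | ∃ q : ℕ, (t : ℝ) ≤ q ∧ (q : ℝ) ≤ (1 + ε) * t ∧
        ∃ s ∈ ξ, x ∈ s ∧ (⇑e)^[q] x ∈ s} =
        ⋃ q : ℕ, ⋃ (_ : (t : ℝ) ≤ q), ⋃ (_ : (q : ℝ) ≤ (1 + ε) * t),
          ⋃ s ∈ ξ, (s ∩ (⇑e)^[q] ⁻¹' s) := by
      ext x; simp only [Set.mem_iUnion, Set.mem_ofPred_eq, Set.mem_inter_iff, Set.mem_preimage, exists_prop]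
    rw [this]
    refine MeasurableSet.iUnion fun q => MeasurableSet.iUnion fun _ => MeasurableSet.iUnion fun _ =>
      Finset.measurableSet_biUnion _ fun s hs => (hmeas s hs).inter ((hme.iterate q) (hmeas s hs))
  · filter_upwards [h1] with x hx
    obtain ⟨T, hT⟩ := hx
    filter_upwards [eventually_ge_atTop T] with t ht
    simpa using hT t ht
end

section
/- Let f : X → X be a homeomorphism of the compact metric space X, μ an ergodic f-invariant Borel probability measure, A ⊆ X a Borel set, ξ a finite partition of X into Borel sets, and δ, ε > 0. For t ∈ ℕ define Λ^t = { x ∈ A : f^q(x) ∈ ξ(x) for some integer q with t ≤ q ≤ (1+ε)t, and D(E_n(x), μ) < δ for all n ≥ t }, where ξ(x) is the element of ξ containing x. Then μ(Λ^t) → μ(A) as t → ∞. -/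
open MeasureTheory Filter Topology
open scoped ENNReal NNReal

/-- Garsia's maximal function, defined recursively. -/
noncomputable def garsiaM {X : Type*} (f : X → X) (g : X → ℝ) : ℕ → X → ℝ
  | 0 => fun _ => 0
  | n + 1 => fun x => max 0 (g x + garsiaM f g n (f x))

lemma garsiaM_nonneg {X : Type*} (f : X → X) (g : X → ℝ) (n : ℕ) (x : X) :
    0 ≤ garsiaM f g n x := by
  cases n with
  | zero => exact le_rfl
  | succ n => exact le_max_left _ _

lemma garsiaM_le_succ {X : Type*} (f : X → X) (g : X → ℝ) (n : ℕ) :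
    ∀ x : X, garsiaM f g n x ≤ garsiaM f g (n + 1) x := by
  induction n with
  | zero => intro x; exact le_max_left _ _
  | succ n ih =>
    intro x
    have := ih (f x)
    exact max_le_max le_rfl (by linarith)

lemma garsiaM_mono {X : Type*} (f : X → X) (g : X → ℝ) (x : X) :
    Monotone (fun n => garsiaM f g n x) :=
  monotone_nat_of_le_succ fun n => garsiaM_le_succ f g n x

lemma birkhoffSum_le_garsiaM {X : Type*} (f : X → X) (g : X → ℝ) (n : ℕ) :
    ∀ x : X, birkhoffSum f g n x ≤ garsiaM f g n x := by
  induction n with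
  | zero => intro x; simp [garsiaM]
  | succ n ih =>
    intro x
    rw [birkhoffSum_succ']
    have := ih (f x)
    exact le_trans (by linarith) (le_max_right _ _)

lemma garsiaM_measurable {X : Type*} [MeasurableSpace X] {f : X → X} {g : X → ℝ}
    (hf : Measurable f) (hg : Measurable g) (n : ℕ) : Measurable (garsiaM f g n) := by
  induction n with
  | zero => exact measurable_const
  | succ n ih => exact measurable_const.max (hg.add (ih.comp hf))

lemma garsiaM_integrable {X : Type*} [MeasurableSpace X] {μ : Measure X} [IsFiniteMeasure μ]
    {f : X → X} {g : X → ℝ}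
    (hf : MeasurePreserving f μ μ) (hg : Integrable g μ) (n : ℕ) :
    Integrable (garsiaM f g n) μ := by
  induction n with
  | zero => exact integrable_zero _ _ _
  | succ n ih =>
    exact (integrable_const (0 : ℝ)).sup (hg.add (hf.integrable_comp_of_integrable ih))

lemma garsia_bdd {X : Type*} [MeasurableSpace X] {μ : Measure X} [IsProbabilityMeasure μ]
    {f : X → X} {g : X → ℝ} (hf : Ergodic f μ) (hg : Measurable g) (hgi : Integrable g μ)
    (hneg : ∫ x, g x ∂μ < 0) :
    ∀ᵐ x ∂μ, ∃ C : ℝ, ∀ n, birkhoffSum f g n x ≤ C := by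
  set E : Set X := {x | ∀ k : ℕ, ∃ n, (k : ℝ) < garsiaM f g n x} with hE
  have hfm : Measurable f := hf.measurable
  have hEm : MeasurableSet E := by
    have : E = ⋂ k : ℕ, ⋃ n, {x | (k : ℝ) < garsiaM f g n x} := by
      ext x; simp [hE]
    rw [this]
    exact MeasurableSet.iInter fun k => MeasurableSet.iUnion fun n =>
      measurableSet_lt measurable_const (garsiaM_measurable hfm hg n)
  have hEinv : f ⁻¹' E = E := by
    ext x
    constructor
    · intro h k
      obtain ⟨k', hk'⟩ := exists_nat_gt ((k : ℝ) - g x)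
      obtain ⟨n, hn⟩ := h k'
      exact ⟨n + 1, lt_of_lt_of_le (by linarith) (le_max_right _ _)⟩
    · intro h k
      obtain ⟨k', hk'⟩ := exists_nat_gt ((k : ℝ) + g x)
      obtain ⟨n, hn⟩ := h (max k' 0)
      have hk0 : (0 : ℝ) ≤ k' := Nat.cast_nonneg _
      simp only [Nat.zero_le, max_eq_left] at hn
      cases n with
      | zero => simp only [garsiaM] at hn; linarith
      | succ n =>
        refine ⟨n, ?_⟩
        rcases lt_max_iff.1 (show (k' : ℝ) < max 0 (g x + garsiaM f g n (f x)) from hn) with h1 | h1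
        · linarith
        · linarith
  rcases hf.toPreErgodic.ae_mem_or_ae_notMem hEm hEinv with h | h
  · exfalso
    have hlim : Tendsto (fun n => ∫ x, (garsiaM f g (n + 1) x - garsiaM f g n (f x)) ∂μ) atTop
        (𝓝 (∫ x, g x ∂μ)) := by
      refine tendsto_integral_of_dominated_convergence (fun x => |g x|) (fun n => ?_) hgi.abs
        (fun n => ?_) ?_
      · exact ((garsiaM_measurable hfm hg (n + 1)).sub
          ((garsiaM_measurable hfm hg n).comp hfm)).aestronglyMeasurable
      · filter_upwards with x
        have h0 := garsiaM_nonneg f g n (f x)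
        have hd : garsiaM f g (n + 1) x = max 0 (g x + garsiaM f g n (f x)) := rfl
        rw [hd, Real.norm_eq_abs, abs_le]
        have := neg_abs_le (g x)
        have := le_abs_self (g x)
        have := abs_nonneg (g x)
        constructor
        · have := le_max_right 0 (g x + garsiaM f g n (f x))
          linarith
        · have : max 0 (g x + garsiaM f g n (f x)) ≤ |g x| + garsiaM f g n (f x) :=
            max_le (by linarith) (by linarith)
          linarith
      · filter_upwards [h] with x hx
        have hx' : f x ∈ E := by
          have : x ∈ f ⁻¹' E := by rw [hEinv]; exact hx
          exact this
        obtain ⟨k, hk⟩ := exists_nat_gt (-(g x))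
        obtain ⟨N, hN⟩ := hx' k
        refine tendsto_const_nhds.congr' ?_
        filter_upwards [eventually_ge_atTop N] with n hn
        have h1 := garsiaM_mono f g (f x) hn
        have hd : garsiaM f g (n + 1) x = max 0 (g x + garsiaM f g n (f x)) := rfl
        simp only at h1
        rw [hd, max_eq_right (by linarith)]
        ring
    have hnn : ∀ n, 0 ≤ ∫ x, (garsiaM f g (n + 1) x - garsiaM f g n (f x)) ∂μ := by
      intro n
      have hi := garsiaM_integrable hf.toMeasurePreserving hgi n
      have hi1 := garsiaM_integrable hf.toMeasurePreserving hgi (n + 1)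
      have hic : Integrable (fun x => garsiaM f g n (f x)) μ :=
        hf.toMeasurePreserving.integrable_comp_of_integrable hi
      have he : ∫ x, garsiaM f g n (f x) ∂μ = ∫ x, garsiaM f g n x ∂μ := by
        conv_rhs => rw [← hf.toMeasurePreserving.map_eq]
        rw [integral_map hfm.aemeasurable (garsiaM_measurable hfm hg n).aestronglyMeasurable]
      rw [integral_sub hi1 hic, he]
      have := integral_mono hi hi1 (fun x => garsiaM_le_succ f g n x)
      linarith
    have := ge_of_tendsto' hlim hnn
    linarith
  · filter_upwards [h] with x hx
    simp only [hE, Set.mem_setOf_eq, not_forall, not_exists, not_lt] at hx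
    obtain ⟨k, hk⟩ := hx
    exact ⟨k, fun n => (birkhoffSum_le_garsiaM f g n x).trans (hk n)⟩

lemma birkhoff_upper {X : Type*} [MeasurableSpace X] {μ : Measure X} [IsProbabilityMeasure μ]
    {f : X → X} {g : X → ℝ} (hf : Ergodic f μ) (hg : Measurable g) (hgi : Integrable g μ) :
    ∀ᵐ x ∂μ, ∀ η : ℝ, 0 < η → ∀ᶠ n : ℕ in atTop,
      birkhoffSum f g n x ≤ n * (∫ x, g x ∂μ + η) := by
  have key : ∀ k : ℕ, ∀ᵐ x ∂μ, ∃ C : ℝ, ∀ n,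
      birkhoffSum f (fun x => g x - (∫ x, g x ∂μ + 1 / ((k : ℝ) + 1))) n x ≤ C := by
    intro k
    refine garsia_bdd hf (hg.sub_const _) (hgi.sub (integrable_const _)) ?_
    rw [integral_sub hgi (integrable_const _)]
    have : (0 : ℝ) < 1 / ((k : ℝ) + 1) := by positivity
    simp
    positivity
  filter_upwards [ae_all_iff.2 key] with x hx η hη
  obtain ⟨k, hk⟩ := exists_nat_one_div_lt (half_pos hη)
  obtain ⟨C, hC⟩ := hx k
  obtain ⟨N, hN⟩ := exists_nat_gt (C / (η / 2))
  filter_upwards [eventually_ge_atTop N] with n hn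
  have h1 := hC n
  simp only [birkhoffSum, Finset.sum_sub_distrib, Finset.sum_const, Finset.card_range,
    nsmul_eq_mul] at h1
  have h2 : C < n * (η / 2) := by
    rw [div_lt_iff₀ (by positivity)] at hN
    have : (N : ℝ) ≤ n := by exact_mod_cast hn
    nlinarith
  have h3 : (n : ℝ) * (1 / ((k : ℝ) + 1)) ≤ n * (η / 2) :=
    mul_le_mul_of_nonneg_left hk.le (Nat.cast_nonneg _)
  simp only [birkhoffSum]
  linarith

lemma birkhoff_both {X : Type*} [MeasurableSpace X] {μ : Measure X} [IsProbabilityMeasure μ]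
    {f : X → X} {g : X → ℝ} (hf : Ergodic f μ) (hg : Measurable g) (hgi : Integrable g μ) :
    ∀ᵐ x ∂μ, ∀ η : ℝ, 0 < η → ∀ᶠ n : ℕ in atTop,
      |birkhoffSum f g n x - n * ∫ x, g x ∂μ| ≤ n * η := by
  filter_upwards [birkhoff_upper hf hg hgi, birkhoff_upper hf hg.neg hgi.neg] with x h1 h2 η hη
  filter_upwards [h1 η hη, h2 η hη] with n h1 h2
  rw [birkhoffSum_neg] at h2
  simp only [Pi.neg_apply, integral_neg] at h2
  rw [abs_le]
  constructor <;> linarith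

lemma return_time {X : Type*} (f : X → X) (s : Set X) (x : X) (p ε : ℝ) (hp : 0 < p) (hε : 0 < ε)
    (h : ∀ η : ℝ, 0 < η → ∀ᶠ n : ℕ in atTop,
      |birkhoffSum f (s.indicator (fun _ => (1 : ℝ))) n x - n * p| ≤ n * η) :
    ∀ᶠ t : ℕ in atTop, ∃ q : ℕ, (t : ℝ) ≤ q ∧ (q : ℝ) ≤ (1 + ε) * t ∧ f^[q] x ∈ s := by
  set η : ℝ := p * ε / (2 * (2 + ε)) with hη
  have hηp : 0 < η := by positivity
  have hη2 : η * (2 + ε) = p * ε / 2 := by rw [hη]; field_simp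
  have hηlt : η < p := by
    nlinarith [mul_pos hp hε]
  obtain ⟨T, hT⟩ := eventually_atTop.1 (h η hηp)
  filter_upwards [eventually_ge_atTop T, eventually_gt_atTop 0] with t ht ht0
  by_contra hcon
  push Not at hcon
  have ht0' : (0 : ℝ) < t := by exact_mod_cast ht0
  set N := ⌊(1 + ε) * (t : ℝ)⌋₊ + 1 with hN
  have hN1 : (1 + ε) * (t : ℝ) < N := by
    rw [hN]; push_cast; exact Nat.lt_floor_add_one _
  have hNt : t ≤ N := by
    have : (t : ℝ) < N := by nlinarith [mul_pos hε ht0']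
    exact_mod_cast this.le
  have hS : birkhoffSum f (s.indicator (fun _ => (1 : ℝ))) N x
      = birkhoffSum f (s.indicator (fun _ => (1 : ℝ))) t x := by
    unfold birkhoffSum
    symm
    apply Finset.sum_subset (Finset.range_mono hNt)
    intro i hi hi'
    simp only [Finset.mem_range, not_lt] at hi hi'
    apply Set.indicator_of_notMem
    apply hcon i (by exact_mod_cast hi')
    have : i ≤ ⌊(1 + ε) * (t : ℝ)⌋₊ := by omega
    exact (Nat.cast_le.2 this).trans (Nat.floor_le (by positivity))
  have h1 := (abs_le.1 (hT t ht)).2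
  have h2 := (abs_le.1 (hT N (ht.trans hNt))).1
  rw [hS] at h2
  have h3 : (p - η) * ((1 + ε) * t) ≤ (p - η) * N :=
    mul_le_mul_of_nonneg_left hN1.le (by linarith)
  have h4 : 0 < (p * ε / 2) * t := by positivity
  have h5 : η * (2 + ε) * t = p * ε / 2 * t := by rw [hη2]
  nlinarith

lemma integral_empMeasure {X : Type*} [TopologicalSpace X] [CompactSpace X] [MeasurableSpace X]
    [BorelSpace X] (f : X → X) (x : X) (n : ℕ) (φ : C(X, ℝ)) :
    ∫ y, φ y ∂(empMeasure f x n) = (n : ℝ)⁻¹ * birkhoffSum f φ n x := by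
  have hm : StronglyMeasurable (φ : X → ℝ) := φ.continuous.measurable.stronglyMeasurable
  unfold empMeasure birkhoffSum
  rw [integral_smul_measure, integral_finsetSum_measure]
  · simp [integral_dirac' _ _ hm]
  · intro i _
    exact (integrable_const ‖φ‖).mono' hm.aestronglyMeasurable
      (Eventually.of_forall fun y => φ.norm_coe_le_norm y)

theorem stmt7 {X : Type*} [MetricSpace X] [CompactSpace X] [MeasurableSpace X] [BorelSpace X]
    (f : X ≃ₜ X)
    (φ : ℕ → C(X, ℝ)) (hφ : ∀ i, φ i ≠ 0)
    (hdense : Dense (Submodule.span ℝ (Set.range φ) : Set C(X, ℝ)))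
    (μ : ProbabilityMeasure X) (hErg : Ergodic ⇑f (μ : Measure X))
    (A : Set X) (hA : MeasurableSet A)
    (ξ : Finset (Set X)) (hmeas : ∀ s ∈ ξ, MeasurableSet s)
    (hdisj : ∀ s ∈ ξ, ∀ t ∈ ξ, s ≠ t → Disjoint s t)
    (hcover : ⋃ s ∈ ξ, s = Set.univ)
    (δ ε : ℝ) (hδ : 0 < δ) (hε : 0 < ε)
    (Λ : ℕ → Set X)
    (hΛ : ∀ t : ℕ, Λ t = {x : X | x ∈ A ∧
        (∃ q : ℕ, (t : ℝ) ≤ q ∧ (q : ℝ) ≤ (1 + ε) * t ∧ ∃ s ∈ ξ, x ∈ s ∧ (⇑f)^[q] x ∈ s) ∧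
        ∀ n : ℕ, t ≤ n → Dmet φ (empirical (⇑f) x n : Measure X) (μ : Measure X) < δ}) :
    Tendsto (fun t : ℕ => (μ : Measure X) (Λ t)) atTop (𝓝 ((μ : Measure X) A)) := by
  -- a.e. point satisfies the return condition eventually
  have hret : ∀ᵐ x ∂(μ : Measure X), ∀ᶠ t : ℕ in atTop,
      ∃ q : ℕ, (t : ℝ) ≤ q ∧ (q : ℝ) ≤ (1 + ε) * t ∧ ∃ s ∈ ξ, x ∈ s ∧ (⇑f)^[q] x ∈ s := by
    have hs : ∀ s ∈ ξ, ∀ᵐ x ∂(μ : Measure X), x ∈ s → ∀ᶠ t : ℕ in atTop,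
        ∃ q : ℕ, (t : ℝ) ≤ q ∧ (q : ℝ) ≤ (1 + ε) * t ∧ (⇑f)^[q] x ∈ s := by
      intro s hs
      rcases eq_or_ne ((μ : Measure X) s) 0 with h0 | h0
      · filter_upwards [measure_eq_zero_iff_ae_notMem.1 h0] with x hx hxs
        exact absurd hxs hx
      · have hp : 0 < (μ : Measure X).real s :=
          ENNReal.toReal_pos h0 (measure_ne_top _ _)
        filter_upwards [birkhoff_both (g := s.indicator (fun _ => (1 : ℝ))) hErg
          (measurable_const.indicator (hmeas s hs))
          ((integrable_const _).indicator (hmeas s hs))] with x hx _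
        refine return_time f s x _ ε hp hε ?_
        have : ∫ x, s.indicator (fun _ => (1 : ℝ)) x ∂(μ : Measure X) = (μ : Measure X).real s := by
          rw [integral_indicator (hmeas s hs)]; simp
        rwa [this] at hx
    have hall := (ae_ball_iff ξ.countable_toSet).2 hs
    filter_upwards [hall] with x hx
    have hxm : x ∈ ⋃ s ∈ ξ, s := by rw [hcover]; trivial
    simp only [Set.mem_iUnion, exists_prop] at hxm
    obtain ⟨s, hsξ, hxs⟩ := hxm
    filter_upwards [hx s hsξ hxs] with t ⟨q, h1, h2, h3⟩
    exact ⟨q, h1, h2, s, hsξ, hxs, h3⟩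
  -- a.e. point is generic
  have hgen : ∀ᵐ x ∂(μ : Measure X), Tendsto
      (fun n => Dmet φ (empirical (⇑f) x n : Measure X) (μ : Measure X)) atTop (𝓝 0) := by
    have hint : ∀ (ν : Measure X) [IsProbabilityMeasure ν] (i : ℕ), Integrable (φ i) ν := by
      intro ν _ i
      exact (integrable_const ‖φ i‖).mono' (φ i).continuous.measurable.aestronglyMeasurable
        (Eventually.of_forall fun y => (φ i).norm_coe_le_norm y)
    have hbd : ∀ (ν : Measure X) [IsProbabilityMeasure ν] (i : ℕ), |∫ y, φ i y ∂ν| ≤ ‖φ i‖ := by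
      intro ν _ i
      have := norm_integral_le_of_norm_le_const (μ := ν)
        (Eventually.of_forall fun y => (φ i).norm_coe_le_norm y)
      simpa using this
    have hb := fun i => birkhoff_both hErg (φ i).continuous.measurable (hint (μ : Measure X) i)
    filter_upwards [ae_all_iff.2 hb] with x hx
    have h0 : (0 : ℝ) = ∑' i : ℕ, (0 : ℝ) := by simp
    rw [h0]
    unfold Dmet
    refine tendsto_tsum_of_dominated_convergence
      (bound := fun i : ℕ => (2 : ℝ)⁻¹ ^ (i + 2) * 2) ?_ ?_ ?_
    · have h := summable_geometric_of_lt_one (r := (2 : ℝ)⁻¹) (by norm_num) (by norm_num)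
      exact ((summable_nat_add_iff 2).2 h).mul_right 2
    · intro i
      have hlim : Tendsto (fun n => (∫ y, φ i y ∂(empirical (⇑f) x n : Measure X))
          - ∫ y, φ i y ∂(μ : Measure X)) atTop (𝓝 0) := by
        rw [Metric.tendsto_atTop]
        intro η hη
        obtain ⟨N, hN⟩ := eventually_atTop.1 (hx i (η / 2) (half_pos hη))
        refine ⟨N, fun n hn => ?_⟩
        have h1 := hN (n + 1) (by omega)
        have h2 : ∫ y, φ i y ∂(empirical (⇑f) x n : Measure X)
            = ((n + 1 : ℕ) : ℝ)⁻¹ * birkhoffSum f (φ i) (n + 1) x :=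
          integral_empMeasure f x (n + 1) (φ i)
        have hpos : (0 : ℝ) < ((n + 1 : ℕ) : ℝ) := by positivity
        rw [Real.dist_eq, sub_zero, h2]
        have h3 : ((n + 1 : ℕ) : ℝ)⁻¹ * birkhoffSum f (φ i) (n + 1) x
            - ∫ y, φ i y ∂(μ : Measure X) = (birkhoffSum f (φ i) (n + 1) x
            - ((n + 1 : ℕ) : ℝ) * ∫ y, φ i y ∂(μ : Measure X)) / ((n + 1 : ℕ) : ℝ) := by
          field_simp
        rw [h3, abs_div, abs_of_pos hpos, div_lt_iff₀ hpos]
        nlinarith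
      have := ((hlim.abs.const_mul ((2 : ℝ)⁻¹ ^ (i + 2))).div_const ‖φ i‖)
      simpa using this
    · refine Eventually.of_forall fun n i => ?_
      have hpos : 0 < ‖φ i‖ := norm_pos_iff.2 (hφ i)
      have h1 := hbd (empirical (⇑f) x n : Measure X) i
      have h2 := hbd (μ : Measure X) i
      have h3 := abs_sub (∫ y, φ i y ∂(empirical (⇑f) x n : Measure X))
        (∫ y, φ i y ∂(μ : Measure X))
      rw [Real.norm_eq_abs, abs_of_nonneg (by positivity), div_le_iff₀ hpos, mul_assoc]
      exact mul_le_mul_of_nonneg_left (by linarith) (by positivity)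
  -- conclusion
  set B : ℕ → Set X := fun T => ⋂ t ≥ T, Λ t with hB
  have hBmono : Monotone B := by
    intro a b hab x hx
    simp only [hB, Set.mem_iInter] at hx ⊢
    exact fun t ht => hx t (le_trans hab ht)
  have hlim := tendsto_measure_iUnion_atTop (μ := (μ : Measure X)) hBmono
  have hΛA : ∀ t, Λ t ⊆ A := by
    intro t x hx
    rw [hΛ] at hx
    exact hx.1
  have hBΛ : ∀ t, B t ⊆ Λ t := by
    intro t x hx
    simp only [hB, Set.mem_iInter] at hx
    exact hx t le_rfl
  have hU : (μ : Measure X) (⋃ T, B T) = (μ : Measure X) A := by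
    apply le_antisymm
    · exact measure_mono (Set.iUnion_subset fun t => (hBΛ t).trans (hΛA t))
    · apply measure_mono_ae
      filter_upwards [hret, hgen] with x h1 h2 hxA
      obtain ⟨T1, hT1⟩ := eventually_atTop.1 h1
      obtain ⟨T2, hT2⟩ := eventually_atTop.1 (h2.eventually (gt_mem_nhds hδ))
      refine Set.mem_iUnion.2 ⟨max T1 T2, ?_⟩
      simp only [hB, Set.mem_iInter]
      intro t ht
      rw [hΛ]
      exact ⟨hxA, hT1 t (le_trans (le_max_left _ _) ht),
        fun n hn => hT2 n ((le_trans (le_max_right _ _) ht).trans hn)⟩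
  rw [hU] at hlim
  exact tendsto_of_tendsto_of_tendsto_of_le_of_le hlim tendsto_const_nhds
    (fun t => measure_mono (hBΛ t)) (fun t => measure_mono (hΛA t))
end

section
/- Let f : X → X be a bijection with f and f^{-1} measurable, preserving a Borel probability measure μ. Let Γ ⊆ X be measurable with μ(Γ) > 0 and set Ω = ⋃_{n∈ℤ} f^n(Γ). For every γ > 0 there exists a measurable function N₀ : Ω → ℕ such that for μ-almost every x ∈ Ω, every integer n ≥ N₀(x) and every t ∈ [0,1], there is some l ∈ {0, 1, …, n} with f^l(x) ∈ Γ and |l/n − t| < γ. -/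
open MeasureTheory Filter Topology
open scoped ENNReal NNReal

lemma stmt8_zpow {X : Type*} [MeasurableSpace X] (μ : Measure X)
    (e : Equiv.Perm X) (h : MeasurePreserving ⇑e μ μ) (h' : MeasurePreserving ⇑e.symm μ μ) (n : ℤ) :
    MeasurePreserving ⇑(e ^ n) μ μ := by
  cases n with
  | ofNat k =>
    have := h.iterate k
    rw [Equiv.Perm.iterate_eq_pow] at this
    simpa using this
  | negSucc k =>
    have := h'.iterate (k+1)
    rw [Equiv.Perm.iterate_eq_pow] at this
    rw [zpow_negSucc, ← inv_pow]
    exact this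

/-- points of `Γ` with no return in times `1..j` -/
def stmt8A {X : Type*} (e : Equiv.Perm X) (Γ : Set X) (j : ℕ) : Set X :=
  {x | x ∈ Γ ∧ ∀ i : ℕ, 1 ≤ i → i ≤ j → (⇑e)^[i] x ∉ Γ}

lemma stmt8A_meas {X : Type*} [MeasurableSpace X] (e : Equiv.Perm X) (hme : Measurable ⇑e)
    (Γ : Set X) (hΓm : MeasurableSet Γ) (j : ℕ) : MeasurableSet (stmt8A e Γ j) := by
  have : stmt8A e Γ j = Γ ∩ ⋂ i : ℕ, ⋂ _ : 1 ≤ i, ⋂ _ : i ≤ j, ((⇑e)^[i] ⁻¹' Γ)ᶜ := by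
    ext x; simp [stmt8A]
  rw [this]
  exact hΓm.inter (MeasurableSet.iInter fun i => MeasurableSet.iInter fun _ =>
    MeasurableSet.iInter fun _ => ((hme.iterate i) hΓm).compl)

lemma stmt8_kac {X : Type*} [MeasurableSpace X] (μ : Measure X) [IsProbabilityMeasure μ]
    (e : Equiv.Perm X) (hme : Measurable ⇑e) (h' : MeasurePreserving ⇑e.symm μ μ)
    (Γ : Set X) (hΓm : MeasurableSet Γ) : ∑' j, μ (stmt8A e Γ j) ≤ 1 := by
  have hm := stmt8A_meas e hme Γ hΓm
  have h1 : ∀ j, μ ((⇑e.symm)^[j] ⁻¹' stmt8A e Γ j) = μ (stmt8A e Γ j) := fun j =>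
    (h'.iterate j).measure_preimage (hm j).nullMeasurableSet
  have hlt : ∀ i j : ℕ, i < j → Disjoint ((⇑e.symm)^[i] ⁻¹' stmt8A e Γ i)
      ((⇑e.symm)^[j] ⁻¹' stmt8A e Γ j) := by
    intro i j hij
    rw [Set.disjoint_left]
    intro x hx hy
    refine hy.2 (j - i) (by omega) (by omega) ?_
    have : (⇑e.symm)^[j] x = (⇑e.symm)^[j-i] ((⇑e.symm)^[i] x) := by
      rw [← Function.iterate_add_apply]; congr 2; omega
    rw [this, (Function.LeftInverse.iterate (g := ⇑e) (f := ⇑e.symm) e.apply_symm_apply (j-i)) _]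
    exact hx.1
  have hd : Pairwise (Function.onFun Disjoint fun j => (⇑e.symm)^[j] ⁻¹' stmt8A e Γ j) := by
    intro i j hij
    rcases lt_or_gt_of_ne hij with h | h
    · exact hlt i j h
    · exact (hlt j i h).symm
  have h2 := measure_iUnion (μ := μ) hd (fun j => (h'.measurable.iterate j) (hm j))
  simp only [h1] at h2
  rw [← h2]
  exact prob_le_one

lemma stmt8_bc {X : Type*} [MeasurableSpace X] (μ : Measure X) [IsProbabilityMeasure μ]
    (e : Equiv.Perm X) (hme : Measurable ⇑e) (h : MeasurePreserving ⇑e μ μ)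
    (h' : MeasurePreserving ⇑e.symm μ μ)
    (Γ : Set X) (hΓm : MeasurableSet Γ) (K : ℕ) (hK : 0 < K) :
    ∀ᵐ x ∂μ, ∀ᶠ m : ℕ in atTop, (⇑e)^[m] x ∉ stmt8A e Γ (m / K) := by
  have hm := stmt8A_meas e hme Γ hΓm
  have : NeZero K := ⟨hK.ne'⟩
  refine ae_eventually_notMem (s := fun m => (⇑e)^[m] ⁻¹' stmt8A e Γ (m / K)) ?_
  have h1 : ∀ m, μ ((⇑e)^[m] ⁻¹' stmt8A e Γ (m / K)) = μ (stmt8A e Γ (m / K)) := fun m =>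
    (h.iterate m).measure_preimage (hm _).nullMeasurableSet
  simp only [h1]
  have h2 : ∑' m : ℕ, μ (stmt8A e Γ (m / K)) = ∑' p : ℕ × Fin K, μ (stmt8A e Γ p.1) :=
    (Nat.divModEquiv K).tsum_eq (fun p : ℕ × Fin K => μ (stmt8A e Γ p.1))
  rw [h2, ENNReal.tsum_prod (f := fun (j : ℕ) (_ : Fin K) => μ (stmt8A e Γ j))]
  simp only [tsum_fintype, Finset.sum_const, Finset.card_univ, Fintype.card_fin, nsmul_eq_mul]
  rw [ENNReal.tsum_mul_left]
  exact ENNReal.mul_ne_top (ENNReal.natCast_ne_top K)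
    (ne_top_of_le_ne_top ENNReal.one_ne_top (stmt8_kac μ e hme h' Γ hΓm))

lemma stmt8_rec {X : Type*} [MeasurableSpace X] (μ : Measure X) [IsProbabilityMeasure μ]
    (e : Equiv.Perm X) (h : MeasurePreserving ⇑e μ μ)
    (h' : MeasurePreserving ⇑e.symm μ μ)
    (Γ : Set X) (hΓm : MeasurableSet Γ) :
    ∀ᵐ x ∂μ, x ∈ (⋃ n : ℤ, ⇑(e ^ n) '' Γ) → ∀ M : ℕ, ∃ m ≥ M, (⇑e)^[m] x ∈ Γ := by
  have h1 := h.conservative.ae_mem_imp_frequently_image_mem hΓm.nullMeasurableSet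
  have h2 : ∀ᵐ x ∂μ, ∀ n : ℤ, (e ^ n) x ∈ Γ → ∃ᶠ m in atTop, (⇑e)^[m] ((e ^ n) x) ∈ Γ := by
    rw [ae_all_iff]
    intro n
    exact (stmt8_zpow μ e h h' n).quasiMeasurePreserving.ae h1
  filter_upwards [h2] with x hx hxΩ M
  obtain ⟨n, y, hy, rfl⟩ := Set.mem_iUnion.1 hxΩ
  have e1 : (e ^ (-n)) ((e ^ n) y) = y := by
    rw [← Equiv.Perm.mul_apply, ← zpow_add]; simp
  have h3 := hx (-n)
  rw [e1] at h3
  obtain ⟨m, hm, hmΓ⟩ := (frequently_atTop.1 (h3 hy)) (M + n.natAbs)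
  refine ⟨(m - n).toNat, by omega, ?_⟩
  have e2 : (⇑e)^[(m - n).toNat] ((e ^ n) y) = (⇑e)^[m] y := by
    rw [Equiv.Perm.iterate_eq_pow, Equiv.Perm.iterate_eq_pow, ← zpow_natCast e (m - n).toNat,
      ← zpow_natCast e m, ← Equiv.Perm.mul_apply, ← zpow_add]
    congr 2; omega
  rwa [e2]

lemma stmt8_det {X : Type*} (e : Equiv.Perm X) (Γ : Set X) (γ : ℝ) (hγ : 0 < γ)
    (K : ℕ) (hK : 0 < K) (hKγ : 1 < γ * K) (x : X) (L : ℕ) (hL : (⇑e)^[L] x ∈ Γ)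
    (hA : ∀ m ≥ L, (⇑e)^[m] x ∉ stmt8A e Γ (m / K)) (n : ℕ) (hn : ⌈L / γ⌉₊ + L + 1 ≤ n)
    (t : ℝ) (ht : t ∈ Set.Icc (0 : ℝ) 1) :
    ∃ l : ℕ, l ≤ n ∧ (⇑e)^[l] x ∈ Γ ∧ |(l : ℝ) / n - t| < γ := by
  classical
  have hn0 : (0 : ℝ) < n := by exact_mod_cast (by omega : 0 < n)
  obtain ⟨ht0, ht1⟩ := ht
  have key : ∀ l : ℕ, |(l : ℝ) - t * n| < γ * n → |(l : ℝ) / n - t| < γ := by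
    intro l hl
    have : (l : ℝ) / n - t = (l - t * n) / n := by field_simp
    rw [this, abs_div, abs_of_pos hn0, div_lt_iff₀ hn0]
    exact hl
  have htn : t * n ≤ n := by nlinarith
  have htn0 : 0 ≤ t * n := by positivity
  rcases lt_or_ge (t * n) L with hc | hc
  · refine ⟨L, by omega, hL, key L ?_⟩
    have h1 : (L : ℝ) / γ < n := lt_of_le_of_lt (Nat.le_ceil _)
      (by exact_mod_cast (by omega : ⌈L / γ⌉₊ < n))
    rw [div_lt_iff₀ hγ] at h1
    rw [abs_of_nonneg (by linarith)]
    linarith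
  · set T := ⌊t * n⌋₊ with hT
    have hLT : L ≤ T := Nat.le_floor hc
    have hTle : (T : ℝ) ≤ t * n := Nat.floor_le htn0
    set l := Nat.findGreatest (fun k => (⇑e)^[k] x ∈ Γ) T with hl
    have hlΓ : (⇑e)^[l] x ∈ Γ := Nat.findGreatest_spec (P := fun k => (⇑e)^[k] x ∈ Γ) hLT hL
    have hLl : L ≤ l := Nat.le_findGreatest hLT hL
    have hlT : l ≤ T := Nat.findGreatest_le T
    have hlT' : (l : ℝ) ≤ T := by exact_mod_cast hlT
    have hln : (l : ℝ) ≤ n := by linarith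
    refine ⟨l, by exact_mod_cast hln, hlΓ, key l ?_⟩
    have h1 := hA l hLl
    simp only [stmt8A, Set.mem_setOf_eq, not_and, not_forall, not_not] at h1
    obtain ⟨i, hi1, hi2, hi3⟩ := h1 hlΓ
    rw [← Function.iterate_add_apply] at hi3
    have hgt : T < i + l := by
      by_contra hcon
      exact Nat.findGreatest_is_greatest (P := fun k => (⇑e)^[k] x ∈ Γ)
        (show l < i + l by omega) (by omega) hi3
    have h2 : t * n < (i : ℝ) + l := by
      have := (Nat.floor_lt htn0).1 hgt
      exact_mod_cast this
    have h3 : i * K ≤ l := (Nat.le_div_iff_mul_le hK).1 hi2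
    have h3' : (i : ℝ) * K ≤ l := by exact_mod_cast h3
    have hK' : (0 : ℝ) < K := by exact_mod_cast hK
    have h4 : (i : ℝ) ≤ γ * n := by
      have : (i : ℝ) * K ≤ (γ * n) * K := by nlinarith
      exact le_of_mul_le_mul_right this hK'
    rw [abs_of_nonpos (by linarith)]
    linarith

/-- quantitative Poincaré recurrence: Let `f` be an invertible bimeasurable
map preserving a probability measure `μ`, `Γ` measurable with `μ(Γ) > 0`, and
`Ω = ⋃_{n∈ℤ} f^n(Γ)`. For every `γ > 0` there is a measurable `N₀ : Ω → ℕ` such that for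
a.e. `x ∈ Ω`, every `n ≥ N₀(x)` and every `t ∈ [0,1]` there is `l ∈ {0,…,n}` with
`f^l(x) ∈ Γ` and `|l/n − t| < γ`. -/
theorem stmt8 {X : Type*} [MeasurableSpace X] (μ : Measure X) [IsProbabilityMeasure μ]
    (e : Equiv.Perm X) (hme : Measurable ⇑e) (hme' : Measurable ⇑e.symm)
    (hpres : MeasurePreserving ⇑e μ μ)
    (Γ : Set X) (hΓm : MeasurableSet Γ) (hΓ : 0 < μ Γ)
    (Ω : Set X) (hΩ : Ω = ⋃ n : ℤ, ⇑(e ^ n) '' Γ)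
    (γ : ℝ) (hγ : 0 < γ) :
    ∃ N₀ : Ω → ℕ, Measurable N₀ ∧
      ∀ᵐ x ∂μ, ∀ hx : x ∈ Ω, ∀ n : ℕ, N₀ ⟨x, hx⟩ ≤ n → ∀ t : ℝ, t ∈ Set.Icc (0 : ℝ) 1 →
        ∃ l : ℕ, l ≤ n ∧ (⇑e)^[l] x ∈ Γ ∧ |(l : ℝ) / n - t| < γ := by
  classical
  have h' : MeasurePreserving ⇑e.symm μ μ := by
    let E : X ≃ᵐ X := ⟨e, hme, hme'⟩
    have hE : MeasurePreserving ⇑E μ μ := hpres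
    exact hE.symm E
  obtain ⟨K, hK⟩ := exists_nat_gt (1 / γ)
  have hK0 : 0 < K := by
    have : (0 : ℝ) < K := lt_trans (by positivity) hK
    exact_mod_cast this
  have hKγ : 1 < γ * K := by
    rw [div_lt_iff₀ hγ] at hK; linarith
  let B : ℕ → Set X := fun L => {x | (⇑e)^[L] x ∈ Γ ∧
    ∀ m ≥ L, (⇑e)^[m] x ∉ stmt8A e Γ (m / K)}
  have hB : ∀ L, MeasurableSet (B L) := by
    intro L
    have : B L = (⇑e)^[L] ⁻¹' Γ ∩ ⋂ m : ℕ, ⋂ _ : m ≥ L, ((⇑e)^[m] ⁻¹' stmt8A e Γ (m / K))ᶜ := by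
      ext x; simp [B]
    rw [this]
    exact ((hme.iterate L) hΓm).inter (MeasurableSet.iInter fun m => MeasurableSet.iInter fun _ =>
      ((hme.iterate m) (stmt8A_meas e hme Γ hΓm _)).compl)
  let p : X → ℕ → Prop := fun x L => x ∈ B L ∪ (⋃ k, B k)ᶜ
  have hp : ∀ x, ∃ L, p x L := by
    intro x
    by_cases hx : x ∈ ⋃ k, B k
    · obtain ⟨L, hL⟩ := Set.mem_iUnion.1 hx
      exact ⟨L, Or.inl hL⟩
    · exact ⟨0, Or.inr hx⟩
  have hfind : Measurable fun x => Nat.find (hp x) :=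
    measurable_find hp fun L => (hB L).union (MeasurableSet.iUnion hB).compl
  refine ⟨fun x => (fun L : ℕ => ⌈(L : ℝ) / γ⌉₊ + L + 1) (Nat.find (hp x.1)),
    (measurable_from_nat (f := fun L : ℕ => ⌈(L : ℝ) / γ⌉₊ + L + 1)).comp
      (hfind.comp measurable_subtype_coe), ?_⟩
  filter_upwards [stmt8_bc μ e hme hpres h' Γ hΓm K hK0, stmt8_rec μ e hpres h' Γ hΓm]
    with x hx1 hx2 hx n hn t ht
  rw [hΩ] at hx
  obtain ⟨M, hM⟩ := eventually_atTop.1 hx1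
  obtain ⟨L, hLM, hLΓ⟩ := hx2 hx M
  have hxB : x ∈ ⋃ k, B k := Set.mem_iUnion.2 ⟨L, hLΓ, fun m hm => hM m (le_trans hLM hm)⟩
  have hs : x ∈ B (Nat.find (hp x)) := by
    rcases Nat.find_spec (hp x) with h | h
    · exact h
    · exact absurd hxB h
  exact stmt8_det e Γ γ hγ K hK0 hKγ x _ hs.1 hs.2 n hn t ht
end

section
/- Let X and Y be compact metric spaces, T : X → X and S : Y → Y continuous maps, and π : X → Y a continuous surjection satisfying π ∘ T = S ∘ π. Then for every ergodic S-invariant Borel probability measure m on Y there exists an ergodic T-invariant Borel probability measure ν on X with π_*ν = m. -/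
open MeasureTheory Filter Topology
open scoped ENNReal NNReal BoundedContinuousFunction

theorem aux_lift {X Y : Type*}
    [MetricSpace X] [CompactSpace X] [MeasurableSpace X] [BorelSpace X]
    [MetricSpace Y] [CompactSpace Y] [MeasurableSpace Y] [BorelSpace Y]
    (π : X → Y) (hπ : Continuous π) (hsurj : Function.Surjective π)
    (m : ProbabilityMeasure Y) :
    ∃ l : ProbabilityMeasure X, l.map hπ.measurable.aemeasurable = m := by
  obtain ⟨s, hs⟩ := hsurj.hasRightInverse
  obtain ⟨y₀⟩ := m.nonempty
  let f : ℕ → SimpleFunc Y Y := fun n =>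
    SimpleFunc.approxOn id measurable_id Set.univ y₀ (Set.mem_univ _) n
  have hf : ∀ y, Tendsto (fun n => f n y) atTop (𝓝 y) := fun y =>
    SimpleFunc.tendsto_approxOn measurable_id (Set.mem_univ _) (by simp)
  let ms : ℕ → ProbabilityMeasure Y := fun n => m.map (f n).measurable.aemeasurable
  have hms : Tendsto ms atTop (𝓝 m) := by
    rw [ProbabilityMeasure.tendsto_iff_forall_integral_tendsto]
    intro g
    have h1 : ∀ n, ∫ y, g y ∂(ms n : Measure Y) = ∫ y, g (f n y) ∂(m : Measure Y) := fun n =>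
      integral_map (f n).measurable.aemeasurable g.continuous.aestronglyMeasurable
    simp_rw [h1]
    refine tendsto_integral_of_dominated_convergence (fun _ => ‖g‖) (fun n => ?_) (by simp)
      (fun n => ?_) ?_
    · exact (g.continuous.measurable.comp (f n).measurable).aestronglyMeasurable
    · exact Eventually.of_forall fun y => g.norm_coe_le_norm _
    · exact Eventually.of_forall fun y => (g.continuous.tendsto y).comp (hf y)
  have hcl : IsClosed (Set.range fun l : ProbabilityMeasure X =>
      l.map hπ.measurable.aemeasurable) :=
    (isCompact_range (ProbabilityMeasure.continuous_map hπ)).isClosed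
  refine hcl.mem_of_tendsto hms (Eventually.of_forall fun n => ?_)
  refine ⟨m.map ((f n).map s).measurable.aemeasurable, ?_⟩
  apply ProbabilityMeasure.toMeasure_injective
  simp only [ProbabilityMeasure.toMeasure_map, ms]
  rw [Measure.map_map hπ.measurable ((f n).map s).measurable]
  congr 1
  ext y
  simp [hs (f n y)]

theorem aux_inv {X Y : Type*}
    [MetricSpace X] [CompactSpace X] [MeasurableSpace X] [BorelSpace X]
    [MetricSpace Y] [CompactSpace Y] [MeasurableSpace Y] [BorelSpace Y]
    (T : X → X) (hT : Continuous T) (S : Y → Y)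
    (π : X → Y) (hπ : Continuous π)
    (hcomm : π ∘ T = S ∘ π)
    (m : ProbabilityMeasure Y) (hm : MeasurePreserving S (m : Measure Y) m)
    (l : ProbabilityMeasure X) (hl : l.map hπ.measurable.aemeasurable = m) :
    ∃ ν : ProbabilityMeasure X, ν.map hπ.measurable.aemeasurable = m ∧
      ν.map hT.measurable.aemeasurable = ν := by
  have hl' : (l : Measure X).map π = m := congrArg Subtype.val hl
  have hTk : ∀ k, Measurable T^[k] := fun k => (hT.iterate k).measurable
  have hprob : ∀ k, IsProbabilityMeasure ((l : Measure X).map T^[k]) := fun k =>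
    Measure.isProbabilityMeasure_map (hTk k).aemeasurable
  let w : ℕ → ℝ≥0∞ := fun n => ((n + 1 : ℕ) : ℝ≥0∞)⁻¹
  have hw : ∀ n, w n * ((n + 1 : ℕ) : ℝ≥0∞) = 1 := fun n =>
    ENNReal.inv_mul_cancel (by simp) (ENNReal.natCast_ne_top _)
  let A : ℕ → Measure X := fun n => w n • ∑ k ∈ Finset.range (n + 1), (l : Measure X).map T^[k]
  have hA : ∀ n, IsProbabilityMeasure (A n) := fun n => ⟨by
    simp only [A, Measure.smul_apply, Measure.finsetSum_apply, measure_univ]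
    simpa using hw n⟩
  have hcommk : ∀ k, π ∘ T^[k] = S^[k] ∘ π := fun k => by
    have : Function.Semiconj π T S := fun x => congrFun hcomm x
    exact funext fun x => (this.iterate_right k) x
  have hAπ : ∀ n, (A n).map π = m := fun n => by
    ext B hB
    rw [Measure.map_apply hπ.measurable hB]
    simp only [A, Measure.smul_apply, Measure.finsetSum_apply]
    have : ∀ k, (l : Measure X).map T^[k] (π ⁻¹' B) = (m : Measure Y) B := fun k => by
      rw [← Measure.map_apply hπ.measurable hB, Measure.map_map hπ.measurable (hTk k), hcommk,
        ← Measure.map_map (hm.iterate k).measurable hπ.measurable, hl', (hm.iterate k).map_eq]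
    simp only [this, Finset.sum_const, Finset.card_range, nsmul_eq_mul, smul_eq_mul]
    rw [← mul_assoc, hw, one_mul]
  let P : ℕ → ProbabilityMeasure X := fun n => ⟨A n, hA n⟩
  let U : Ultrafilter ℕ := hyperfilter ℕ
  have hU : (U : Filter ℕ) ≤ atTop := Nat.hyperfilter_le_atTop
  obtain ⟨ν, -, hν⟩ := isCompact_univ.ultrafilter_le_nhds (U.map P) (by simp)
  have hν : Tendsto P U (𝓝 ν) := hν
  refine ⟨ν, ?_, ?_⟩
  · have h1 := ProbabilityMeasure.tendsto_map_of_tendsto_of_continuous P ν hν hπ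
    have h2 : (fun i => (P i).map hπ.measurable.aemeasurable) = fun _ => m := by
      funext n
      exact Subtype.ext (hAπ n)
    rw [h2] at h1
    exact tendsto_nhds_unique h1 tendsto_const_nhds
  · have h1 := ProbabilityMeasure.tendsto_map_of_tendsto_of_continuous P ν hν hT
    apply ProbabilityMeasure.toMeasure_injective
    apply ext_of_forall_integral_eq_of_IsFiniteMeasure
    intro g
    have h2 := (ProbabilityMeasure.tendsto_iff_forall_integral_tendsto.1 h1) g
    have h3 := (ProbabilityMeasure.tendsto_iff_forall_integral_tendsto.1 hν) g
    have h4 := h2.sub h3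
    rw [← sub_eq_zero]
    refine tendsto_nhds_unique h4 (Tendsto.mono_left ?_ hU)
    let a : ℕ → ℝ := fun k => ∫ x, g (T^[k] x) ∂(l : Measure X)
    have ha : ∀ k, |a k| ≤ ‖g‖ := fun k => by
      have := norm_integral_le_of_norm_le_const (μ := (l : Measure X)) (f := fun x => g (T^[k] x))
        (C := ‖g‖) (Eventually.of_forall fun x => g.norm_coe_le_norm _)
      simpa [a] using this
    have hI : ∀ (h : X →ᵇ ℝ) n, ∫ x, h x ∂(A n) =
        (n + 1 : ℝ)⁻¹ * ∑ k ∈ Finset.range (n + 1), ∫ x, h (T^[k] x) ∂(l : Measure X) := by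
      intro h n
      simp only [A]
      rw [integral_smul_measure, integral_finsetSum_measure]
      · congr 1
        · simp only [w, ENNReal.toReal_inv, ENNReal.toReal_natCast]
          push_cast
          rfl
        · refine Finset.sum_congr rfl fun k _ => ?_
          exact integral_map (hTk k).aemeasurable h.continuous.aestronglyMeasurable
      · intro k _
        exact h.integrable _
    have key : ∀ n, ∫ x, g x ∂((P n).map hT.measurable.aemeasurable : Measure X)
        - ∫ x, g x ∂(P n : Measure X) = (n + 1 : ℝ)⁻¹ * (a (n + 1) - a 0) := by
      intro n
      have e1 : ∫ x, g x ∂((P n).map hT.measurable.aemeasurable : Measure X)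
          = ∫ x, (g.compContinuous ⟨T, hT⟩) x ∂(A n) :=
        integral_map hT.measurable.aemeasurable g.continuous.aestronglyMeasurable
      have e2 : ∫ x, g x ∂(P n : Measure X) = ∫ x, g x ∂(A n) := rfl
      rw [e1, e2, hI, hI, ← mul_sub, ← Finset.sum_sub_distrib, ← Finset.sum_range_sub]
      congr 1
      refine Finset.sum_congr rfl fun k _ => ?_
      simp [a, Function.iterate_succ_apply']
    simp_rw [key]
    have hz : Tendsto (fun n : ℕ => (n + 1 : ℝ)⁻¹ * (‖g‖ + ‖g‖)) atTop (𝓝 0) := by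
      have := (tendsto_one_div_add_atTop_nhds_zero_nat (𝕜 := ℝ)).mul_const (‖g‖ + ‖g‖)
      simpa using this
    refine squeeze_zero_norm (fun n => ?_) hz
    rw [norm_mul, Real.norm_eq_abs, Real.norm_eq_abs, abs_of_nonneg (by positivity)]
    gcongr
    exact (abs_sub _ _).trans (add_le_add (ha _) (ha _))

/-- If `π : X → Y` is a continuous surjection between compact metric spaces
intertwining continuous maps `T` and `S` (`π ∘ T = S ∘ π`), then every ergodic `S`-invariant
Borel probability measure `m` on `Y` lifts to an ergodic `T`-invariant Borel probability
measure `ν` on `X` with `π_*ν = m`. -/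
theorem stmt11 {X Y : Type*}
    [MetricSpace X] [CompactSpace X] [MeasurableSpace X] [BorelSpace X]
    [MetricSpace Y] [CompactSpace Y] [MeasurableSpace Y] [BorelSpace Y]
    (T : X → X) (hT : Continuous T) (S : Y → Y) (hS : Continuous S)
    (π : X → Y) (hπ : Continuous π) (hsurj : Function.Surjective π)
    (hcomm : π ∘ T = S ∘ π)
    (m : Measure Y) [IsProbabilityMeasure m] (hm : Ergodic S m) :
    ∃ ν : Measure X, IsProbabilityMeasure ν ∧ Ergodic T ν ∧ ν.map π = m := by
  let m' : ProbabilityMeasure Y := ⟨m, inferInstance⟩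
  obtain ⟨l, hl⟩ := aux_lift π hπ hsurj m'
  obtain ⟨ν₀, hν₀, hν₀'⟩ := aux_inv T hT S π hπ hcomm m' hm.toMeasurePreserving l hl
  let K : Set (ProbabilityMeasure X) := {ν | ν.map hπ.measurable.aemeasurable = m' ∧
      ν.map hT.measurable.aemeasurable = ν}
  have hK : IsCompact K := by
    apply IsClosed.isCompact
    exact (isClosed_eq (ProbabilityMeasure.continuous_map hπ) continuous_const).inter
      (isClosed_eq (ProbabilityMeasure.continuous_map hT) continuous_id)
  let Φ : ProbabilityMeasure X → ((X →ᵇ ℝ) → ℝ) := fun ν f => ∫ x, f x ∂(ν : Measure X)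
  have hΦ : Continuous Φ := continuous_pi fun f =>
    ProbabilityMeasure.continuous_integral_boundedContinuousFunction f
  have hinj : Function.Injective Φ := fun a b hab =>
    ProbabilityMeasure.toMeasure_injective
      (ext_of_forall_integral_eq_of_IsFiniteMeasure fun f => congrFun hab f)
  obtain ⟨z, hz⟩ := (hK.image hΦ).extremePoints_nonempty ⟨_, ν₀, ⟨hν₀, hν₀'⟩, rfl⟩
  rw [mem_extremePoints_iff_left] at hz
  obtain ⟨⟨ν, ⟨hν1, hν2⟩, rfl⟩, hext⟩ := hz
  have hνπ : (ν : Measure X).map π = m := congrArg Subtype.val hν1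
  have hνT : (ν : Measure X).map T = ν := congrArg Subtype.val hν2
  refine ⟨ν, inferInstance, Ergodic.of_mem_extremePoints ?_, hνπ⟩
  rw [mem_extremePoints_iff_left]
  refine ⟨⟨⟨hT.measurable, hνT⟩, inferInstance⟩, ?_⟩
  have hmem : ∀ (μ : Measure X) (hp : IsProbabilityMeasure μ), MeasurePreserving T μ μ →
      μ ≪ (ν : Measure X) → (⟨μ, hp⟩ : ProbabilityMeasure X) ∈ K := by
    intro μ hp hμ hac
    have hp' : IsProbabilityMeasure (μ.map π) :=
      Measure.isProbabilityMeasure_map hπ.measurable.aemeasurable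
    refine ⟨Subtype.ext ?_, Subtype.ext hμ.map_eq⟩
    change μ.map π = m
    refine hm.eq_of_absolutelyContinuous ⟨hS.measurable, ?_⟩ ?_
    · rw [Measure.map_map hS.measurable hπ.measurable, ← hcomm,
        ← Measure.map_map hπ.measurable hT.measurable, hμ.map_eq]
    · rw [← hνπ]
      exact hac.map hπ.measurable
  rintro ν₁ ⟨hT₁, hp₁⟩ ν₂ ⟨hT₂, hp₂⟩ ⟨a, b, ha, hb, hab, h⟩
  have hac₁ : ν₁ ≪ (ν : Measure X) := by
    rw [← h]
    refine Measure.AbsolutelyContinuous.mk fun s _ hs => ?_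
    simp [ha.ne', hb.ne'] at hs
    exact hs.1
  have hac₂ : ν₂ ≪ (ν : Measure X) := by
    rw [← h]
    refine Measure.AbsolutelyContinuous.mk fun s _ hs => ?_
    simp [ha.ne', hb.ne'] at hs
    exact hs.2
  have hat : a ≠ ∞ := fun h' => by simp [h'] at hab
  have hbt : b ≠ ∞ := fun h' => by simp [h'] at hab
  have := hext _ ⟨_, hmem ν₁ hp₁ hT₁ hac₁, rfl⟩ _ ⟨_, hmem ν₂ hp₂ hT₂ hac₂, rfl⟩
    ⟨a.toReal, b.toReal, ENNReal.toReal_pos ha.ne' hat, ENNReal.toReal_pos hb.ne' hbt, by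
      rw [← ENNReal.toReal_add hat hbt, hab, ENNReal.toReal_one], by
      funext f
      change a.toReal * ∫ x, f x ∂ν₁ + b.toReal * ∫ x, f x ∂ν₂ = ∫ x, f x ∂(ν : Measure X)
      rw [← h, integral_add_measure ((f.integrable _).smul_measure hat)
        ((f.integrable _).smul_measure hbt), integral_smul_measure, integral_smul_measure]
      rfl⟩
  exact congrArg Subtype.val (hinj this)
end

section
/- Let f : X → X be a bijection with f and f^{-1} measurable, preserving an ergodic Borel probability measure m, let R ⊆ X be measurable, and let c ∈ ℝ and 0 < γ ≤ 1 satisfy m(R) < c + γ/2. For N ∈ ℕ let Γ_N(c,γ) = { x ∈ X : for all n ∈ ℤ and all k ≥ 1, #{ j ∈ ℤ : n ≤ j ≤ n+k−1, f^j(x) ∈ R } ≤ N + k(c+γ) + |n|γ }, and Γ(c,γ) = ⋃_{N≥1} Γ_N(c,γ). Then m(Γ(c,γ)) = 1. -/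
open MeasureTheory Filter Topology
open scoped ENNReal NNReal

noncomputable def mxF {X : Type*} (f : X → X) (g : X → ℝ) : ℕ → X → ℝ
  | 0, _ => 0
  | n + 1, x => max 0 (g x + mxF f g n (f x))

lemma mxF_nonneg {X : Type*} (f : X → X) (g : X → ℝ) (n : ℕ) (x : X) : 0 ≤ mxF f g n x := by
  cases n <;> simp [mxF]

lemma mxF_mono {X : Type*} (f : X → X) (g : X → ℝ) (n : ℕ) :
    ∀ x : X, mxF f g n x ≤ mxF f g (n + 1) x := by
  induction n with
  | zero => intro x; simp [mxF]
  | succ n ih =>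
    intro x
    have := ih (f x)
    rw [mxF, mxF]
    gcongr

lemma sum_le_mxF {X : Type*} (f : X → X) (g : X → ℝ) (n : ℕ) :
    ∀ x : X, ∑ j ∈ Finset.range n, g (f^[j] x) ≤ mxF f g n x := by
  induction n with
  | zero => intro x; simp [mxF]
  | succ n ih =>
    intro x
    have := ih (f x)
    rw [Finset.sum_range_succ', mxF]
    simp only [Function.iterate_succ_apply, Function.iterate_zero_apply]
    refine le_trans ?_ (le_max_right _ _)
    linarith

lemma mxF_meas {X : Type*} [MeasurableSpace X] {f : X → X} {g : X → ℝ} (hf : Measurable f)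
    (hg : Measurable g) (n : ℕ) : Measurable (mxF f g n) := by
  induction n with
  | zero => exact measurable_const
  | succ n ih =>
    exact measurable_const.max (hg.add (ih.comp hf))

lemma mxF_int {X : Type*} [MeasurableSpace X] {m : Measure X} [IsProbabilityMeasure m]
    {f : X → X} {g : X → ℝ} (hf : MeasurePreserving f m m)
    (hg : Integrable g m) (n : ℕ) : Integrable (mxF f g n) m := by
  induction n with
  | zero => exact integrable_zero _ _ _
  | succ n ih =>
    have h1 : Integrable (fun x => mxF f g n (f x)) m := hf.integrable_comp_of_integrable ih
    exact (integrable_zero X ℝ m).sup (hg.add h1)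

lemma max_erg {X : Type*} [MeasurableSpace X] {m : Measure X} [IsProbabilityMeasure m]
    {f : X → X} {g : X → ℝ} (hf : Ergodic f m) (hgm : Measurable g)
    (hg : Integrable g m) (hneg : ∫ x, g x ∂m < 0) :
    ∀ᵐ x ∂m, ∃ N : ℕ, ∀ n : ℕ, ∑ j ∈ Finset.range n, g (f^[j] x) ≤ N := by
  set B : Set X := {x | ∃ N : ℕ, ∀ n : ℕ, mxF f g n x ≤ N} with hB
  have hBm : MeasurableSet B := by
    have : B = ⋃ N : ℕ, ⋂ n : ℕ, {x | mxF f g n x ≤ N} := by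
      ext x; simp [hB]
    rw [this]
    exact MeasurableSet.iUnion fun N => MeasurableSet.iInter fun n =>
      measurableSet_le (mxF_meas hf.measurable hgm n) measurable_const
  have hinv : f ⁻¹' B = B := by
    ext x
    simp only [hB, Set.mem_preimage, Set.mem_setOf_eq]
    constructor
    · rintro ⟨N, hN⟩
      obtain ⟨M, hM⟩ := exists_nat_ge (max 0 (g x + N))
      refine ⟨M, fun n => (mxF_mono f g n x).trans (le_trans ?_ hM)⟩
      rw [mxF]
      have := hN n
      gcongr
    · rintro ⟨N, hN⟩
      obtain ⟨M, hM⟩ := exists_nat_ge (N - g x)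
      refine ⟨M, fun n => ?_⟩
      have := hN (n + 1)
      rw [mxF] at this
      have := (le_max_right _ _).trans this
      linarith
  rcases hf.toPreErgodic.ae_mem_or_ae_notMem hBm hinv with h | h
  · filter_upwards [h] with x hx
    obtain ⟨N, hN⟩ := hx
    exact ⟨N, fun n => (sum_le_mxF f g n x).trans (hN n)⟩
  · exfalso
    have hmp := hf.toMeasurePreserving
    have key : ∀ n, 0 ≤ ∫ x, max (-mxF f g n (f x)) (g x) ∂m := by
      intro n
      have e1 : ∀ x, max (-mxF f g n (f x)) (g x) = mxF f g (n + 1) x - mxF f g n (f x) := by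
        intro x
        rw [mxF, max_sub_sub_right 0 (g x + mxF f g n (f x)) (mxF f g n (f x)) |>.symm]
        simp
      simp_rw [e1]
      have hi := mxF_int hmp hg n
      have h1 : Integrable (fun x => mxF f g n (f x)) m := hmp.integrable_comp_of_integrable hi
      rw [integral_sub (mxF_int hmp hg (n + 1)) h1]
      have h2 : ∫ x, mxF f g n (f x) ∂m = ∫ x, mxF f g n x ∂m := by
        have := integral_map (μ := m) (φ := f) hmp.measurable.aemeasurable
          (f := mxF f g n) (by rw [hmp.map_eq]; exact hi.aestronglyMeasurable)
        rw [← this, hmp.map_eq]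
      rw [h2, sub_nonneg]
      exact integral_mono hi (mxF_int hmp hg (n + 1)) (mxF_mono f g n)
    have hlim : Tendsto (fun n => ∫ x, max (-mxF f g n (f x)) (g x) ∂m) atTop
        (𝓝 (∫ x, g x ∂m)) := by
      refine tendsto_integral_of_dominated_convergence (fun x => |g x|) ?_ hg.abs ?_ ?_
      · intro n
        exact ((((mxF_meas hmp.measurable hgm n).comp hmp.measurable).neg).max
          hgm).aestronglyMeasurable
      · intro n
        refine Eventually.of_forall fun x => ?_
        have h0 := mxF_nonneg f g n (f x)
        rw [Real.norm_eq_abs, abs_le]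
        refine ⟨(neg_abs_le _).trans (le_max_right _ _), max_le ?_ (le_abs_self _)⟩
        have := abs_nonneg (g x)
        linarith
      · filter_upwards [h] with x hx
        have hx' : f x ∉ B := by
          intro hh
          apply hx
          rw [← hinv]; exact hh
        obtain ⟨N, hN⟩ := exists_nat_ge (-g x)
        have : ∃ n, (N : ℝ) < mxF f g n (f x) := by
          by_contra hcon
          push Not at hcon
          exact hx' ⟨N, hcon⟩
        obtain ⟨n0, hn0⟩ := this
        refine tendsto_const_nhds.congr' ?_
        filter_upwards [eventually_ge_atTop n0] with n hn
        have := (monotone_nat_of_le_succ (f := fun n => mxF f g n (f x))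
          (fun n => mxF_mono f g n (f x))) hn
        simp only at this
        rw [max_eq_right]
        linarith
    exact absurd (ge_of_tendsto' hlim key) (not_le.mpr hneg)

lemma dev_bound {X : Type*} [MeasurableSpace X] {m : Measure X} [IsProbabilityMeasure m]
    {f : X → X} (hf : Ergodic f m) {R : Set X} (hR : MeasurableSet R) {ε : ℝ} (hε : 0 < ε) :
    ∀ᵐ x ∂m, ∃ N : ℕ, ∀ n : ℕ,
      |∑ j ∈ Finset.range n, R.indicator (fun _ => (1 : ℝ)) (f^[j] x) - (m R).toReal * n|
        ≤ N + ε * n := by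
  have hm : Measurable (R.indicator (fun _ => (1 : ℝ))) := measurable_const.indicator hR
  have hi : Integrable (R.indicator (fun _ => (1 : ℝ))) m := (integrable_const 1).indicator hR
  have hI : ∫ x, R.indicator (fun _ => (1 : ℝ)) x ∂m = (m R).toReal := by
    rw [integral_indicator_const _ hR]; simp [Measure.real]
  have h1 := max_erg (g := fun x => R.indicator (fun _ => (1 : ℝ)) x - ((m R).toReal + ε)) hf
    (hm.sub_const _) (hi.sub (integrable_const _)) (by
      rw [integral_sub hi (integrable_const _), hI]; simp; exact hε)
  have h2 := max_erg (g := fun x => ((m R).toReal - ε) - R.indicator (fun _ => (1 : ℝ)) x) hf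
    (measurable_const.sub hm) ((integrable_const _).sub hi) (by
      rw [integral_sub (integrable_const _) hi, hI]; simp; exact hε)
  filter_upwards [h1, h2] with x ⟨N1, hx1⟩ ⟨N2, hx2⟩
  refine ⟨N1 + N2, fun n => ?_⟩
  have a1 := hx1 n
  have a2 := hx2 n
  rw [Finset.sum_sub_distrib] at a1 a2
  simp only [Finset.sum_const, Finset.card_range, nsmul_eq_mul] at a1 a2
  have := Nat.cast_nonneg (α := ℝ) N1
  have := Nat.cast_nonneg (α := ℝ) N2
  push_cast
  rw [abs_le]
  constructor <;> nlinarith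

lemma card_bd {P : ℤ → Prop} [DecidablePred P] (n : ℤ) (k : ℕ) :
    (Set.ncard {j : ℤ | n ≤ j ∧ j ≤ n + k - 1 ∧ P j} : ℝ)
      ≤ ∑ i ∈ Finset.range k, if P (n + i) then (1 : ℝ) else 0 := by
  have : {j : ℤ | n ≤ j ∧ j ≤ n + k - 1 ∧ P j} =
      (((Finset.range k).filter (fun i : ℕ => P (n + i))).image (fun i : ℕ => n + (i : ℤ)) :
        Finset ℤ) := by
    ext j
    simp only [Set.mem_setOf_eq, Finset.coe_image, Finset.coe_filter, Finset.mem_range,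
      Set.mem_image]
    constructor
    · rintro ⟨h1, h2, h3⟩
      have : n + ((j - n).toNat : ℤ) = j := by omega
      exact ⟨(j - n).toNat, ⟨by omega, by rwa [this]⟩, this⟩
    · rintro ⟨i, ⟨h1, h2⟩, rfl⟩
      exact ⟨by omega, by omega, h2⟩
  rw [this, Set.ncard_coe_finset, Finset.sum_boole]
  exact_mod_cast Finset.card_image_le

theorem det_bd (h : ℤ → ℝ) (a ε : ℝ) (N1 N2 : ℕ)
    (h1 : ∀ n : ℕ, |∑ j ∈ Finset.range n, h j - a * n| ≤ N1 + ε * n)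
    (h2 : ∀ n : ℕ, |∑ j ∈ Finset.range n, h (-(j : ℤ) - 1) - a * n| ≤ N2 + ε * n)
    (n : ℤ) (k : ℕ) (hε : 0 ≤ ε) :
    ∑ i ∈ Finset.range k, h (n + i) ≤ 2 * (N1 + N2) + a * k + ε * (2 * |(n : ℝ)| + k) := by
  let T : ℤ → ℝ := fun n => ∑ j ∈ Finset.range n.toNat, h j
    - ∑ j ∈ Finset.range (-n).toNat, h (-(j : ℤ) - 1)
  have hT : ∀ n, T (n + 1) - T n = h n := by
    intro n
    rcases le_or_gt 0 n with hn | hn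
    · obtain ⟨p, rfl⟩ := Int.eq_ofNat_of_zero_le hn
      have e1 : ((p : ℤ) + 1).toNat = p + 1 := by omega
      have e2 : (-((p : ℤ) + 1)).toNat = 0 := by omega
      have e3 : (-(p : ℤ)).toNat = 0 := by omega
      simp only [T, e1, e2, e3, Int.toNat_natCast, Finset.sum_range_succ]
      simp
    · obtain ⟨p, rfl⟩ : ∃ p : ℕ, n = -(p : ℤ) - 1 := ⟨(-n - 1).toNat, by omega⟩
      have e1 : (-(p : ℤ) - 1 + 1).toNat = 0 := by omega
      have e2 : (-(-(p : ℤ) - 1 + 1)).toNat = p := by omega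
      have e3 : (-(p : ℤ) - 1).toNat = 0 := by omega
      have e4 : (-(-(p : ℤ) - 1)).toNat = p + 1 := by omega
      simp only [T, e1, e2, e3, e4, Finset.sum_range_succ]
      simp
  have hB : ∀ n : ℤ, |T n - a * n| ≤ (N1 + N2) + ε * |(n : ℝ)| := by
    intro n
    have p1 := Nat.cast_nonneg (α := ℝ) N1
    have p2 := Nat.cast_nonneg (α := ℝ) N2
    rcases le_total 0 n with hn | hn
    · obtain ⟨p, rfl⟩ := Int.eq_ofNat_of_zero_le hn
      have e3 : (-(p : ℤ)).toNat = 0 := by omega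
      have := h1 p
      simp only [T, e3, Int.toNat_natCast]
      simp only [Finset.range_zero, Finset.sum_empty, sub_zero, Int.cast_natCast, Nat.abs_cast]
      linarith
    · obtain ⟨p, rfl⟩ : ∃ p : ℕ, n = -(p : ℤ) := ⟨(-n).toNat, by omega⟩
      have e3 : (-(p : ℤ)).toNat = 0 := by omega
      have := h2 p
      simp only [T, e3, neg_neg, Int.toNat_natCast]
      simp only [Finset.range_zero, Finset.sum_empty, zero_sub, Int.cast_neg, Int.cast_natCast,
        abs_neg, Nat.abs_cast]
      rw [← abs_neg]
      ring_nf at this ⊢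
      linarith
  have hS : ∑ i ∈ Finset.range k, h (n + i) = T (n + k) - T n := by
    induction k with
    | zero => simp
    | succ k ih =>
      rw [Finset.sum_range_succ, ih, ← hT]
      push_cast
      rw [add_assoc]; ring
  rw [hS]
  have b1 := (abs_le.mp (hB (n + k))).2
  have b2 := (abs_le.mp (hB n)).1
  have b3 : |((n + k : ℤ) : ℝ)| ≤ |(n : ℝ)| + k := by
    push_cast
    exact (abs_add_le _ _).trans (by simp)
  have b4 := mul_le_mul_of_nonneg_left b3 hε
  push_cast at b1 b4
  linarith

/-- Let `f` be an invertible bimeasurable map preserving an ergodic probability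
measure `m`, `R` measurable, `c ∈ ℝ`, `0 < γ ≤ 1` with `m(R) < c + γ/2`. With
`Γ_N(c,γ) = {x : ∀ n ∈ ℤ, k ≥ 1, #{n ≤ j ≤ n+k−1 : f^j(x) ∈ R} ≤ N + k(c+γ) + |n|γ}` and
`Γ(c,γ) = ⋃_N Γ_N(c,γ)`, one has `m(Γ(c,γ)) = 1`. -/
theorem stmt12 {X : Type*} [MeasurableSpace X] (m : Measure X) [IsProbabilityMeasure m]
    (e : Equiv.Perm X) (hme' : Measurable ⇑e.symm) (hErg : Ergodic ⇑e m)
    (R : Set X) (hRm : MeasurableSet R) (c γ : ℝ) (hγ0 : 0 < γ) (hγ1 : γ ≤ 1)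
    (hmR : (m R).toReal < c + γ / 2)
    (Γ : ℕ → Set X)
    (hΓ : ∀ N : ℕ, Γ N = {x : X | ∀ n : ℤ, ∀ k : ℕ, 1 ≤ k →
        (Set.ncard {j : ℤ | n ≤ j ∧ j ≤ n + k - 1 ∧ (e ^ j) x ∈ R} : ℝ) ≤
          N + k * (c + γ) + |(n : ℝ)| * γ}) :
    m (⋃ N : ℕ, Γ N) = 1 := by
  classical
  let E : X ≃ᵐ X := ⟨e, hErg.measurable, hme'⟩
  have hsmp : MeasurePreserving e.symm m m :=
    MeasurePreserving.symm E (show MeasurePreserving E m m from hErg.toMeasurePreserving)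
  have hsE : Ergodic e.symm m := Ergodic.symm (e := E) hErg
  have hR' : MeasurableSet (e.symm ⁻¹' R) := hme' hRm
  have hmm : m (e.symm ⁻¹' R) = m R := hsmp.measure_preimage hRm.nullMeasurableSet
  have d1 := dev_bound hErg hRm (half_pos hγ0)
  have d2 := dev_bound hsE hR' (half_pos hγ0)
  rw [hmm] at d2
  have hae : ∀ᵐ x ∂m, x ∈ ⋃ N : ℕ, Γ N := by
    filter_upwards [d1, d2] with x ⟨N1, hx1⟩ ⟨N2, hx2⟩
    rw [Set.mem_iUnion]
    refine ⟨2 * (N1 + N2), ?_⟩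
    rw [hΓ]
    intro n k hk
    refine (card_bd (P := fun j => (e ^ j) x ∈ R) n k).trans ?_
    have := det_bd (fun j => if (e ^ j) x ∈ R then (1 : ℝ) else 0) (m R).toReal (γ / 2) N1 N2
      (fun n => by
        convert hx1 n using 5 with j hj
        simp [Set.indicator_apply, Equiv.Perm.iterate_eq_pow])
      (fun n => by
        convert hx2 n using 5 with j hj
        have : (e ^ (-(j : ℤ) - 1)) x = e.symm (e.symm^[j] x) := by
          rw [← Function.iterate_succ_apply' (⇑e.symm) j x, Equiv.Perm.iterate_eq_pow]
          rw [show -(j : ℤ) - 1 = -((j + 1 : ℕ) : ℤ) by push_cast; ring, zpow_neg, zpow_natCast,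
            ← inv_pow]
          rfl
        rw [this]
        simp [Set.indicator_apply]) n k (half_pos hγ0).le
    refine this.trans ?_
    push_cast
    have hk0 := Nat.cast_nonneg (α := ℝ) k
    nlinarith
  exact (prob_compl_eq_zero_iff₀ (NullMeasurableSet.of_compl (NullMeasurableSet.of_null hae))).mp hae
end

section
/- Let k ≥ 1 be an integer and b > 0 be such that for all 1 ≤ j ≤ k and all u, v ∈ X with d(u,v) < b one has |φ_j(u) − φ_j(v)| ≤ ‖φ_j‖_∞ / k. If z, x ∈ X and m ≥ 0, n ≥ 1 are integers such that d(f^{m+q}(z), f^q(x)) < b for every 0 ≤ q ≤ n−1, then D(E_n(f^m(z)), E_n(x)) ≤ 1/k + 2^{1−k}. -/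
open MeasureTheory Filter Topology
open scoped ENNReal NNReal

lemma integral_empMeasure_aux {X : Type*} [MetricSpace X] [CompactSpace X] [MeasurableSpace X]
    [BorelSpace X] (f : X → X) (x : X) (n : ℕ) (g : C(X, ℝ)) :
    ∫ y, g y ∂(empMeasure f x n) = (n : ℝ)⁻¹ * ∑ i ∈ Finset.range n, g (f^[i] x) := by
  unfold empMeasure
  rw [integral_smul_measure, integral_finsetSum_measure]
  · simp [integral_dirac]
  · intro i _
    exact g.continuous.integrable_of_hasCompactSupport (HasCompactSupport.of_compactSpace _)

lemma diff_empMeasure_aux {X : Type*} [MetricSpace X] [CompactSpace X] [MeasurableSpace X]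
    [BorelSpace X] (f : X → X) (x y : X) (n : ℕ) (hn : 1 ≤ n) (g : C(X, ℝ)) (c : ℝ)
    (h : ∀ q, q < n → |g (f^[q] x) - g (f^[q] y)| ≤ c) :
    |(∫ w, g w ∂(empMeasure f x n)) - ∫ w, g w ∂(empMeasure f y n)| ≤ c := by
  have hn0 : (0 : ℝ) < n := by exact_mod_cast hn
  rw [integral_empMeasure_aux, integral_empMeasure_aux, ← mul_sub, ← Finset.sum_sub_distrib,
    abs_mul, abs_of_pos (inv_pos.mpr hn0), inv_mul_le_iff₀ hn0]
  refine (Finset.abs_sum_le_sum_abs _ _).trans ?_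
  refine (Finset.sum_le_sum (fun q hq => h q (Finset.mem_range.mp hq))).trans ?_
  simp

/-- If `b > 0` is a modulus of continuity such that `d(u,v) < b` implies
`|φ_j(u) − φ_j(v)| ≤ ‖φ_j‖/k` for the first `k` test functions (here indexed `j < k`), and if
the orbit segment of `z` starting at time `m` `b`-shadows the orbit segment of `x` of length
`n ≥ 1`, then `D(E_n(f^m z), E_n(x)) ≤ 1/k + 2^{1−k}`. -/
theorem stmt15 {X : Type*} [MetricSpace X] [CompactSpace X] [MeasurableSpace X] [BorelSpace X]
    (f : X → X) (hf : Continuous f)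
    (φ : ℕ → C(X, ℝ)) (hφ : ∀ i, φ i ≠ 0)
    (hdense : Dense (Submodule.span ℝ (Set.range φ) : Set C(X, ℝ)))
    (k : ℕ) (hk : 1 ≤ k) (b : ℝ) (hb : 0 < b)
    (hmod : ∀ j : ℕ, j < k → ∀ u v : X, dist u v < b → |φ j u - φ j v| ≤ ‖φ j‖ / k)
    (z x : X) (m n : ℕ) (hn : 1 ≤ n)
    (hclose : ∀ q : ℕ, q ≤ n - 1 → dist (f^[m + q] z) (f^[q] x) < b) :
    Dmet φ (empMeasure f (f^[m] z) n) (empMeasure f x n) ≤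
      1 / (k : ℝ) + (2 : ℝ) ^ ((1 : ℤ) - (k : ℤ)) := by
  unfold Dmet
  set a : ℕ → ℝ := fun i => (2 : ℝ)⁻¹ ^ (i + 2) *
    |(∫ y, φ i y ∂(empMeasure f (f^[m] z) n)) - ∫ y, φ i y ∂(empMeasure f x n)| / ‖φ i‖ with ha
  have hpos : ∀ i, 0 < ‖φ i‖ := fun i => norm_pos_iff.mpr (hφ i)
  have hk0 : (0 : ℝ) < k := by exact_mod_cast hk
  have ha0 : ∀ i, 0 ≤ a i := fun i => by positivity
  have key : ∀ i c, |(∫ y, φ i y ∂(empMeasure f (f^[m] z) n)) -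
      ∫ y, φ i y ∂(empMeasure f x n)| ≤ c * ‖φ i‖ → a i ≤ (2 : ℝ)⁻¹ ^ (i + 2) * c := by
    intro i c h
    simp only [ha]
    rw [div_le_iff₀ (hpos i), mul_assoc]
    gcongr
  have h2 : ∀ i, a i ≤ (2 : ℝ)⁻¹ ^ (i + 2) * 2 := by
    intro i
    refine key i 2 (diff_empMeasure_aux f _ _ n hn _ _ ?_)
    intro q _
    have h1 := (φ i).norm_coe_le_norm (f^[q] (f^[m] z))
    have h2 := (φ i).norm_coe_le_norm (f^[q] x)
    rw [Real.norm_eq_abs] at h1 h2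
    linarith [abs_sub (φ i (f^[q] (f^[m] z))) (φ i (f^[q] x))]
  have h1 : ∀ i, i < k → a i ≤ (2 : ℝ)⁻¹ ^ (i + 2) * (1 / k) := by
    intro i hi
    refine key i (1 / k) (diff_empMeasure_aux f _ _ n hn _ _ ?_)
    intro q hq
    rw [← Function.iterate_add_apply, add_comm q m, one_div_mul_eq_div]
    exact hmod i hi _ _ (hclose q (by omega))
  have hg : HasSum (fun i : ℕ => (2 : ℝ)⁻¹ ^ i) 2 := by
    have := hasSum_geometric_of_lt_one (r := (2 : ℝ)⁻¹) (by norm_num) (by norm_num)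
    norm_num at this ⊢
    exact this
  have hs : Summable a := by
    refine Summable.of_nonneg_of_le ha0 h2 ?_
    have := hg.summable.mul_left ((2 : ℝ)⁻¹)
    refine this.congr fun i => ?_
    rw [pow_add]; ring
  rw [← hs.sum_add_tsum_nat_add k]
  refine add_le_add ?_ ?_
  · calc ∑ i ∈ Finset.range k, a i
        ≤ ∑ i ∈ Finset.range k, (2 : ℝ)⁻¹ ^ i * ((2 : ℝ)⁻¹ ^ 2 * (1 / k)) := by
          refine Finset.sum_le_sum fun i hi => ?_
          have := h1 i (Finset.mem_range.mp hi)
          rwa [pow_add, mul_assoc] at this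
      _ = (∑ i ∈ Finset.range k, (2 : ℝ)⁻¹ ^ i) * ((2 : ℝ)⁻¹ ^ 2 * (1 / k)) := by
          rw [Finset.sum_mul]
      _ ≤ 2 * ((2 : ℝ)⁻¹ ^ 2 * (1 / k)) := by
          gcongr
          exact sum_le_hasSum _ (fun i _ => by positivity) hg
      _ ≤ 1 / k := by
          have : (0 : ℝ) < 1 / k := by positivity
          linarith
  · have ht : HasSum (fun i : ℕ => (2 : ℝ)⁻¹ ^ i * ((2 : ℝ)⁻¹ ^ k * 2⁻¹))
        (2 * ((2 : ℝ)⁻¹ ^ k * 2⁻¹)) := hg.mul_right _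
    have : ∑' i, a (i + k) ≤ 2 * ((2 : ℝ)⁻¹ ^ k * 2⁻¹) := by
      refine hasSum_le (fun i => ?_) ((summable_nat_add_iff k).mpr hs).hasSum ht
      refine (h2 (i + k)).trans (le_of_eq ?_)
      rw [pow_add, pow_add]; ring
    refine this.trans ?_
    rw [zpow_sub₀ (by norm_num), zpow_one, zpow_natCast, inv_pow, div_eq_mul_inv]
    have : (0 : ℝ) < (2 ^ k)⁻¹ := by positivity
    linarith
end
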